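/- arXiv:1811.12545 — 2 statements merged into one kernel-verified Lean document; each statement's English description precedes it below -/
import Mathlib

section
/- Let ν be a finite Borel measure on ℝ with ν(ℝ) = 1 and with finite, strictly positive first absolute moment c := ∫_ℝ |t| dν(t) ∈ (0, ∞). Define F : ℂ⁺ → ℂ⁺ by F(z) = z + ∫_ℝ (t − z)⁻¹ dν(t). For each n ≥ 1 let μ_n be a probability measure on ℝ satisfying ∫_ℝ (z − t)⁻¹ dμ_n(t) = √n / F^{∘n}(√n z) for all z ∈ ℂ⁺. Then for every integer n > max{(8√(3c))⁴, (8c√c)^(−4)} one has sup_{x ∈ ℝ} |C_{μ_n}(x) − C_γ(x)| ≤ 71 · c^(1/4) · n^(−1/8). -/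
open MeasureTheory Complex Set Filter

/-- The arcsine distribution on ℝ with density `1/(π√(2-t²))` on `(-√2, √2)`. -/
noncomputable def arcsine : Measure ℝ :=
  MeasureTheory.volume.withDensity fun t =>
    ENNReal.ofReal (if t ^ 2 < 2 then (Real.pi * Real.sqrt (2 - t ^ 2))⁻¹ else 0)

/-- Cumulative distribution function of a Borel measure on ℝ. -/
noncomputable def cdfOf (τ : Measure ℝ) (x : ℝ) : ℝ := (τ (Set.Iic x)).toReal

/-- The Poisson kernel of the upper half-plane at height `y`. -/
noncomputable def poissonKernelAt (y u : ℝ) : ℝ := y / (Real.pi * (u ^ 2 + y ^ 2))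

lemma poissonKernelAt_nonneg {y : ℝ} (hy : 0 < y) (u : ℝ) : 0 ≤ poissonKernelAt y u := by
  unfold poissonKernelAt; positivity

lemma poissonKernelAt_neg (y u : ℝ) : poissonKernelAt y (-u) = poissonKernelAt y u := by
  simp [poissonKernelAt]

lemma continuous_poissonKernelAt {y : ℝ} (hy : 0 < y) : Continuous (poissonKernelAt y) := by
  unfold poissonKernelAt
  refine continuous_const.div (by fun_prop) fun u => ?_
  positivity

lemma poissonKernelAt_eq_cauchyPDFReal {y : ℝ} (hy : 0 < y) :
    poissonKernelAt y = ProbabilityTheory.cauchyPDFReal 0 ⟨y, hy.le⟩ := by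
  ext u
  have h : ProbabilityTheory.cauchyPDFReal 0 ⟨y, hy.le⟩ u
    = Real.pi⁻¹ * y * ((u - 0) ^ 2 + y ^ 2)⁻¹ := rfl
  rw [h, poissonKernelAt, sub_zero]
  field_simp

lemma integrable_poissonKernelAt {y : ℝ} (hy : 0 < y) : Integrable (poissonKernelAt y) := by
  rw [poissonKernelAt_eq_cauchyPDFReal hy]
  exact ProbabilityTheory.integrable_cauchyPDFReal 0

lemma integral_poissonKernelAt {y : ℝ} (hy : 0 < y) : ∫ u, poissonKernelAt y u = 1 := by
  rw [poissonKernelAt_eq_cauchyPDFReal hy]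
  exact ProbabilityTheory.integral_cauchyPDFReal_eq_one 0 fun h => hy.ne' (congrArg NNReal.toReal h)

lemma setIntegral_poissonKernelAt {y : ℝ} (hy : 0 < y) :
    ∫ u in Icc (-(√3 * y)) (√3 * y), poissonKernelAt y u = 2 / 3 := by
  have h3 : 0 ≤ √3 * y := by positivity
  have hd : ∀ u : ℝ, HasDerivAt (fun u => Real.arctan (u / y) / Real.pi) (poissonKernelAt y u) u := by
    intro u
    have := ((Real.hasDerivAt_arctan (u / y)).comp u ((hasDerivAt_id u).div_const y)).div_const
      Real.pi
    refine this.congr_deriv ?_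
    unfold poissonKernelAt
    have := Real.pi_pos
    field_simp
    ring
  rw [integral_Icc_eq_integral_Ioc, ← intervalIntegral.integral_of_le (by linarith),
    intervalIntegral.integral_eq_sub_of_hasDerivAt (fun u _ => hd u)
      ((continuous_poissonKernelAt hy).intervalIntegrable _ _)]
  have e1 : √3 * y / y = √3 := by field_simp
  have e2 : -(√3 * y) / y = -√3 := by field_simp
  rw [e1, e2, Real.arctan_neg, Real.arctan_sqrt_three]
  have := Real.pi_pos
  field_simp
  norm_num

lemma integrable_poissonKernelAt_mul {y : ℝ} (hy : 0 < y) {f : ℝ → ℝ} (hf : Measurable f) {D : ℝ}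
    (hD : ∀ x, |f x| ≤ D) : Integrable fun u => poissonKernelAt y u * f u :=
  (integrable_poissonKernelAt hy).mul_bdd (c := D) hf.aestronglyMeasurable
    (Eventually.of_forall fun x => by simpa using hD x)

lemma integrable_and_integral_poissonKernelAt_mul_sqrt_abs {y : ℝ} (hy : 0 < y) :
    Integrable (fun u => poissonKernelAt y u * √|u|) ∧
      ∫ u, poissonKernelAt y u * √|u| ≤ 3 * √y := by
  set g : ℝ → ℝ := fun u => 2 * Real.arctan (√(u / y)) with hg
  set g' : ℝ → ℝ := fun u => 1 / ((1 + u / y) * √(u / y) * y) with hg'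
  have hgd : ∀ u ∈ Ioi (0 : ℝ), HasDerivAt g (g' u) u := by
    intro u hu
    have hu0 : 0 < u / y := div_pos hu hy
    have h1 := ((hasDerivAt_id u).div_const y).sqrt hu0.ne'
    have := ((Real.hasDerivAt_arctan (√(u / y))).comp u h1).const_mul 2
    refine this.congr_deriv ?_
    simp only [hg', id, Real.sq_sqrt hu0.le]
    have : 0 < √(u / y) := Real.sqrt_pos.2 hu0
    field_simp
  have hg0 : ∀ u ∈ Ioi (0 : ℝ), 0 ≤ g' u := by
    intro u hu
    have hu : 0 < u := hu
    simp only [hg']; positivity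
  have hgc : ContinuousWithinAt g (Ici 0) 0 := by
    refine Continuous.continuousWithinAt ?_
    have := Real.continuous_arctan
    simp only [hg]; fun_prop
  have hgl : Tendsto g atTop (nhds (2 * (Real.pi / 2))) := by
    refine Tendsto.const_mul 2 ?_
    have h1 : Tendsto (fun u : ℝ => √(u / y)) atTop atTop :=
      Real.tendsto_sqrt_atTop.comp (tendsto_id.atTop_div_const hy)
    exact (Real.tendsto_arctan_atTop.mono_right nhdsWithin_le_nhds).comp h1
  have hgi := integrableOn_Ioi_deriv_of_nonneg hgc hgd hg0 hgl
  have hgv := integral_Ioi_of_hasDerivAt_of_nonneg hgc hgd hg0 hgl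
  have hle : ∀ u ∈ Ioi (0 : ℝ), poissonKernelAt y u * √u ≤ √y * (3 / (2 * Real.pi)) * g' u := by
    intro u hu
    obtain ⟨s, hs, rfl⟩ : ∃ s, 0 < s ∧ u = y * s ^ 2 :=
      ⟨√(u / y), Real.sqrt_pos.2 (div_pos hu hy), by
        rw [Real.sq_sqrt (div_pos hu hy).le]; field_simp⟩
    have e1 : y * s ^ 2 / y = s ^ 2 := by field_simp
    simp only [hg', poissonKernelAt, e1, Real.sqrt_sq hs.le, Real.sqrt_mul hy.le]
    have hpi := Real.pi_pos
    have hsy : 0 < √y := Real.sqrt_pos.2 hy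
    have e2 : y / (Real.pi * ((y * s ^ 2) ^ 2 + y ^ 2)) * (√y * s)
        = √y / (Real.pi * y) * (s / (s ^ 4 + 1)) := by field_simp
    have e3 : √y * (3 / (2 * Real.pi)) * (1 / ((1 + s ^ 2) * s * y))
        = √y / (Real.pi * y) * (3 / (2 * ((1 + s ^ 2) * s))) := by field_simp
    rw [e2, e3]
    gcongr ?_ * ?_
    rw [div_le_div_iff₀ (by positivity) (by positivity)]
    nlinarith [sq_nonneg (s ^ 2 - 1)]
  have hcont : Continuous fun u : ℝ => poissonKernelAt y u * √u :=
    (continuous_poissonKernelAt hy).mul Real.continuous_sqrt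
  have hint : IntegrableOn (fun u => poissonKernelAt y u * √u) (Ioi 0) := by
    refine Integrable.mono' (hgi.const_mul (√y * (3 / (2 * Real.pi))))
      hcont.aestronglyMeasurable ?_
    filter_upwards [ae_restrict_mem measurableSet_Ioi] with u hu
    rw [Real.norm_of_nonneg (mul_nonneg (poissonKernelAt_nonneg hy u) (Real.sqrt_nonneg u))]
    exact hle u hu
  have hval : ∫ u in Ioi 0, poissonKernelAt y u * √u ≤ √y * (3 / (2 * Real.pi)) * Real.pi := by
    calc _ ≤ ∫ u in Ioi 0, √y * (3 / (2 * Real.pi)) * g' u :=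
          setIntegral_mono_on hint (hgi.const_mul _) measurableSet_Ioi hle
      _ = _ := by
          rw [integral_const_mul, hgv]
          simp only [hg, zero_div, Real.sqrt_zero, Real.arctan_zero]
          ring
  have habs : (fun u => poissonKernelAt y u * √|u|)
      = fun u => (fun v => poissonKernelAt y v * √v) |u| := by
    ext u
    simp [poissonKernelAt]
  have hpos : IntegrableOn (fun u => poissonKernelAt y u * √|u|) (Ioi 0) :=
    hint.congr_fun (fun u hu => by rw [abs_of_pos hu]) measurableSet_Ioi
  have hneg : IntegrableOn (fun u => poissonKernelAt y u * √|u|) (Iic 0) := by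
    rw [integrableOn_Iic_iff_integrableOn_Iio]
    have := (Measure.measurePreserving_neg (volume : Measure ℝ)).integrableOn_comp_preimage
      (Homeomorph.neg ℝ).measurableEmbedding |>.2 hpos
    simpa [Function.comp_def, poissonKernelAt_neg] using this
  refine ⟨by rw [← integrableOn_univ, ← Iic_union_Ioi]; exact hneg.union hpos, ?_⟩
  rw [habs, integral_comp_abs (f := fun v => poissonKernelAt y v * √v)]
  have := Real.pi_pos
  have e : √y * (3 / (2 * Real.pi)) * Real.pi = 3 / 2 * √y := by field_simp
  linarith

/-- One-sided bound for a bounded function with limited downward variation whose Poisson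
smoothing is small. -/
lemma le_of_poisson_smoothing_le {y D δ : ℝ} (hy : 0 < y) {g : ℝ → ℝ} (hg : Measurable g)
    (hD : ∀ x, |g x| ≤ D) (hmono : ∀ x u, 0 ≤ u → g x - √u ≤ g (x + u))
    (hδ : ∀ b, ∫ u, poissonKernelAt y u * g (b - u) ≤ δ) (x : ℝ) :
    g x ≤ 3 / 2 * δ + D / 2 + √(2 * (√3 * y)) := by
  set h := √3 * y with hh
  have h0 : 0 < h := by positivity
  set A := g x - √(2 * h) + D with hA
  have hk := integrable_poissonKernelAt hy
  have key : ∫ u, (poissonKernelAt y u * (-D)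
        + (Icc (-h) h).indicator (fun u => poissonKernelAt y u * A) u)
      ≤ ∫ u, poissonKernelAt y u * g (x + h - u) := by
    refine integral_mono ((hk.mul_const _).add
      ((hk.mul_const A).indicator measurableSet_Icc))
      (integrable_poissonKernelAt_mul hy (by fun_prop) fun u => hD _) fun u => ?_
    have hp := poissonKernelAt_nonneg hy u
    by_cases hu : u ∈ Icc (-h) h
    · simp only [indicator_of_mem hu, ← mul_add]
      refine mul_le_mul_of_nonneg_left ?_ hp
      have h1 := hmono x (h - u) (by linarith [hu.2])
      have h2 : √(h - u) ≤ √(2 * h) := Real.sqrt_le_sqrt (by linarith [hu.1])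
      rw [show x + h - u = x + (h - u) by ring]
      linarith
    · simp only [indicator_of_notMem hu, add_zero]
      refine mul_le_mul_of_nonneg_left ?_ hp
      linarith [abs_le.1 (hD (x + h - u))]
  rw [integral_add (hk.mul_const _) ((hk.mul_const A).indicator measurableSet_Icc),
    integral_mul_const, integral_poissonKernelAt hy, integral_indicator measurableSet_Icc,
    integral_mul_const, setIntegral_poissonKernelAt hy] at key
  have := hδ (x + h)
  linarith

/-- Smoothing inequality: a function `M` which is nondecreasing is uniformly close to a
`1/2`-Hölder function `Q` as soon as its Poisson smoothing is. -/
lemma abs_sub_le_of_poisson_smoothing {y δ : ℝ} (hy : 0 < y) {M Q : ℝ → ℝ} (hM : Monotone M)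
    (hM01 : ∀ x, M x ∈ Icc (0 : ℝ) 1) (hQ01 : ∀ x, Q x ∈ Icc (0 : ℝ) 1)
    (hQ : ∀ x x', |Q x - Q x'| ≤ √|x - x'|)
    (hQm : Measurable Q)
    (hδ : ∀ b, |(∫ u, poissonKernelAt y u * M (b - u)) - Q b| ≤ δ) (x : ℝ) :
    |M x - Q x| ≤ 3 * (δ + 3 * √y) + 2 * √(2 * (√3 * y)) := by
  have hk := integrable_poissonKernelAt hy
  have hMm : Measurable M := hM.measurable
  have hQ1 : ∀ x, |Q x| ≤ 1 := fun x => abs_le.2 ⟨by linarith [(hQ01 x).1], (hQ01 x).2⟩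
  have hM1 : ∀ x, |M x| ≤ 1 := fun x => abs_le.2 ⟨by linarith [(hM01 x).1], (hM01 x).2⟩
  obtain ⟨hsi, hsv⟩ := integrable_and_integral_poissonKernelAt_mul_sqrt_abs hy
  have hQs : ∀ b, |(∫ u, poissonKernelAt y u * Q (b - u)) - Q b| ≤ 3 * √y := by
    intro b
    have e : (∫ u, poissonKernelAt y u * Q (b - u)) - Q b
        = ∫ u, poissonKernelAt y u * (Q (b - u) - Q b) := by
      simp only [mul_sub]
      rw [integral_sub (integrable_poissonKernelAt_mul hy (by fun_prop) fun u => hQ1 _)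
        (hk.mul_const _), integral_mul_const, integral_poissonKernelAt hy, one_mul]
    rw [e, ← Real.norm_eq_abs]
    refine (norm_integral_le_of_norm_le hsi (Eventually.of_forall fun u => ?_)).trans hsv
    rw [norm_mul, Real.norm_of_nonneg (poissonKernelAt_nonneg hy u), Real.norm_eq_abs]
    refine mul_le_mul_of_nonneg_left ((hQ _ _).trans_eq ?_) (poissonKernelAt_nonneg hy u)
    rw [show b - u - b = -u by ring, abs_neg]
  set f : ℝ → ℝ := fun x => M x - Q x with hf
  have hfm : Measurable f := hMm.sub hQm
  have hfs : ∀ b, |∫ u, poissonKernelAt y u * f (b - u)| ≤ δ + 3 * √y := by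
    intro b
    have e : ∫ u, poissonKernelAt y u * f (b - u)
        = (∫ u, poissonKernelAt y u * M (b - u)) - ∫ u, poissonKernelAt y u * Q (b - u) := by
      simp only [hf, mul_sub]
      exact integral_sub (integrable_poissonKernelAt_mul hy (by fun_prop) fun u => hM1 _)
        (integrable_poissonKernelAt_mul hy (by fun_prop) fun u => hQ1 _)
    have h1 := abs_le.1 (hδ b)
    have h2 := abs_le.1 (hQs b)
    rw [e, abs_le]
    constructor <;> linarith
  have hfu : ∀ x u, 0 ≤ u → f x - √u ≤ f (x + u) := by
    intro x u hu
    have h1 := hM (show x ≤ x + u by linarith)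
    have h2 := hQ (x + u) x
    rw [add_sub_cancel_left, abs_of_nonneg hu] at h2
    simp only [hf]
    linarith [(abs_le.1 h2).2]
  have hbdd : BddAbove (range fun x => |f x|) := by
    refine ⟨2, ?_⟩
    rintro _ ⟨x, rfl⟩
    exact (abs_sub _ _).trans (by linarith [hM1 x, hQ1 x])
  set D := ⨆ x, |f x| with hDdef
  have hD : ∀ x, |f x| ≤ D := fun x => le_ciSup hbdd x
  have hup : ∀ x, f x ≤ 3 / 2 * (δ + 3 * √y) + D / 2 + √(2 * (√3 * y)) :=
    le_of_poisson_smoothing_le hy hfm hD hfu fun b => (abs_le.1 (hfs b)).2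
  have hlow : ∀ x, -f (-x) ≤ 3 / 2 * (δ + 3 * √y) + D / 2 + √(2 * (√3 * y)) := by
    refine le_of_poisson_smoothing_le (g := fun x => -f (-x)) hy (by fun_prop)
      (fun x => by rw [abs_neg]; exact hD _) (fun x u hu => ?_) fun b => ?_
    · have := hfu (-(x + u)) u hu
      rw [show -(x + u) + u = -x by ring] at this
      linarith
    · have e : ∫ u, poissonKernelAt y u * -f (-(b - u))
          = -∫ u, poissonKernelAt y u * f (-b - u) := by
        rw [← integral_neg_eq_self, ← integral_neg]
        congr 1
        ext u
        rw [poissonKernelAt_neg, show -(b - -u) = -b - u by ring]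
        ring
      rw [e]
      linarith [(abs_le.1 (hfs (-b))).1]
  have hDle : D ≤ 3 / 2 * (δ + 3 * √y) + D / 2 + √(2 * (√3 * y)) :=
    ciSup_le fun x => abs_le.2 ⟨by have := hlow (-x); rw [neg_neg] at this; linarith, hup x⟩
  have := hD x
  simp only [hf] at this
  linarith

section Dynamics

variable {ν : Measure ℝ} [IsProbabilityMeasure ν]

lemma im_le_norm_ofReal_sub (t : ℝ) (z : ℂ) : z.im ≤ ‖(t : ℂ) - z‖ := by
  have := Complex.abs_im_le_norm ((t : ℂ) - z)
  simp only [Complex.sub_im, Complex.ofReal_im, zero_sub, abs_neg] at this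
  exact (le_abs_self _).trans this

lemma ofReal_sub_ne_zero {z : ℂ} (hz : 0 < z.im) (t : ℝ) : (t : ℂ) - z ≠ 0 :=
  norm_pos_iff.1 (hz.trans_le (im_le_norm_ofReal_sub t z))

lemma norm_ofReal_sub_inv_le {z : ℂ} (hz : 0 < z.im) (t : ℝ) : ‖((t : ℂ) - z)⁻¹‖ ≤ 1 / z.im := by
  rw [norm_inv, one_div]
  exact inv_anti₀ hz (im_le_norm_ofReal_sub t z)

lemma integrable_ofReal_sub_inv (ν : Measure ℝ) [IsFiniteMeasure ν] {z : ℂ} (hz : 0 < z.im) :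
    Integrable (fun t : ℝ => ((t : ℂ) - z)⁻¹) ν := by
  refine Integrable.of_bound (C := 1 / z.im) ?_ (Eventually.of_forall (norm_ofReal_sub_inv_le hz))
  exact (Continuous.inv₀ (by fun_prop) (ofReal_sub_ne_zero hz)).aestronglyMeasurable

lemma norm_integral_ofReal_sub_inv_le {z : ℂ} (hz : 0 < z.im) :
    ‖∫ t, ((t : ℂ) - z)⁻¹ ∂ν‖ ≤ 1 / z.im := by
  simpa using norm_integral_le_of_norm_le_const (μ := ν)
    (Eventually.of_forall (norm_ofReal_sub_inv_le hz))

lemma im_integral_ofReal_sub_inv (ν : Measure ℝ) [IsFiniteMeasure ν] {z : ℂ} (hz : 0 < z.im) :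
    (∫ t, ((t : ℂ) - z)⁻¹ ∂ν).im = ∫ t, z.im / ((z.re - t) ^ 2 + z.im ^ 2) ∂ν := by
  have h := integral_im (𝕜 := ℂ) (integrable_ofReal_sub_inv ν hz)
  simp only [RCLike.im_to_complex] at h
  rw [← h]
  congr 1
  ext t
  rw [Complex.inv_im, Complex.normSq_apply]
  simp only [Complex.sub_im, Complex.ofReal_im, zero_sub, neg_neg, Complex.sub_re,
    Complex.ofReal_re]
  congr 1
  ring

lemma norm_mul_integral_add_one_le (hint : Integrable (fun t => |t|) ν) {z : ℂ}
    (hz : 0 < z.im) :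
    ‖z * (∫ t, ((t : ℂ) - z)⁻¹ ∂ν) + 1‖ ≤ (∫ t, |t| ∂ν) / z.im := by
  have e : z * (∫ t, ((t : ℂ) - z)⁻¹ ∂ν) + 1 = ∫ t, (t : ℂ) * ((t : ℂ) - z)⁻¹ ∂ν := by
    have h1 : ∀ t : ℝ, (t : ℂ) * ((t : ℂ) - z)⁻¹ = z * ((t : ℂ) - z)⁻¹ + 1 := by
      intro t
      have := ofReal_sub_ne_zero hz t
      field_simp
      ring
    simp only [h1]
    rw [integral_add ((integrable_ofReal_sub_inv ν hz).const_mul z) (integrable_const _),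
      integral_const_mul]
    simp
  rw [e, div_eq_mul_one_div, ← integral_mul_const]
  refine norm_integral_le_of_norm_le (hint.mul_const _) (Eventually.of_forall fun t => ?_)
  rw [norm_mul, Complex.norm_real, Real.norm_eq_abs]
  exact mul_le_mul_of_nonneg_left (norm_ofReal_sub_inv_le hz t) (abs_nonneg t)

/-- The iterates of the `F`-transform satisfy `F^[k] z ^ 2 ≈ z ^ 2 - 2 * k`. -/
lemma iterate_sq_approx (hint : Integrable (fun t => |t|) ν) {F : ℂ → ℂ}
    (hF : ∀ z : ℂ, F z = z + ∫ t, ((t : ℂ) - z)⁻¹ ∂ν) {z : ℂ} (hz : 0 < z.im) (k : ℕ) :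
    z.im ≤ (F^[k] z).im ∧
      ‖(F^[k] z) ^ 2 - z ^ 2 + 2 * k‖ ≤ k * (2 * (∫ t, |t| ∂ν) / z.im + 1 / z.im ^ 2) := by
  induction k with
  | zero => simp
  | succ k ih =>
    obtain ⟨ih1, ih2⟩ := ih
    rw [Function.iterate_succ_apply', hF]
    set w := F^[k] z
    have hw : 0 < w.im := hz.trans_le ih1
    set G := ∫ t, ((t : ℂ) - w)⁻¹ ∂ν with hG
    have hGim : 0 ≤ G.im := by
      rw [hG, im_integral_ofReal_sub_inv ν hw]
      exact integral_nonneg fun t => by positivity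
    refine ⟨by rw [Complex.add_im]; linarith, ?_⟩
    have hGn : ‖G‖ ≤ 1 / z.im := (norm_integral_ofReal_sub_inv_le hw).trans (by gcongr)
    have hc : 0 ≤ ∫ t, |t| ∂ν := integral_nonneg fun t => abs_nonneg t
    have hwG : ‖w * G + 1‖ ≤ (∫ t, |t| ∂ν) / z.im :=
      (norm_mul_integral_add_one_le hint hw).trans (by gcongr)
    have e : (w + G) ^ 2 - z ^ 2 + 2 * ((k + 1 : ℕ) : ℂ)
        = (w ^ 2 - z ^ 2 + 2 * k) + (2 * (w * G + 1) + G ^ 2) := by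
      push_cast; ring
    rw [e]
    calc _ ≤ ‖w ^ 2 - z ^ 2 + 2 * k‖ + (‖2 * (w * G + 1)‖ + ‖G ^ 2‖) :=
          (norm_add_le _ _).trans (by gcongr; exact norm_add_le _ _)
      _ ≤ k * (2 * (∫ t, |t| ∂ν) / z.im + 1 / z.im ^ 2)
          + (2 * ((∫ t, |t| ∂ν) / z.im) + (1 / z.im) ^ 2) := by
          rw [norm_mul, norm_pow, Complex.norm_ofNat]
          gcongr
      _ = _ := by push_cast; ring

end Dynamics

/-- If `w` is in the upper half-plane and `w ^ 2` is close to `-s ^ 2`, then `-Im (1 / w)` is not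
much smaller than `1 / s`. -/
lemma inv_sub_im_div_normSq_le {w : ℂ} {s e : ℝ} (hs : 0 < s) (hw : 0 < w.im)
    (h : ‖w ^ 2 + (s : ℂ) ^ 2‖ ≤ e) : 1 / s - w.im / Complex.normSq w ≤ 2 * e / s ^ 3 := by
  have he : 0 ≤ e := (norm_nonneg _).trans h
  have hN : 0 < Complex.normSq w := Complex.normSq_pos.2 fun h0 => by simp [h0] at hw
  rcases le_total (s ^ 2) (2 * e) with h2 | h2
  · have h3 : 1 / s ≤ 2 * e / s ^ 3 := by
      rw [div_le_div_iff₀ hs (by positivity)]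
      nlinarith
    have : 0 ≤ w.im / Complex.normSq w := by positivity
    linarith
  · have hN2 : Complex.normSq w ≤ s ^ 2 + e := by
      rw [Complex.normSq_eq_norm_sq, ← norm_pow]
      calc ‖w ^ 2‖ = ‖(w ^ 2 + (s : ℂ) ^ 2) - (s : ℂ) ^ 2‖ := by ring_nf
        _ ≤ ‖w ^ 2 + (s : ℂ) ^ 2‖ + ‖(s : ℂ) ^ 2‖ := norm_sub_le _ _
        _ ≤ s ^ 2 + e := by
          rw [norm_pow, Complex.norm_real, Real.norm_of_nonneg hs.le]
          linarith
    have hre : w.re ^ 2 - w.im ^ 2 + s ^ 2 ≤ e := by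
      have h3 := (Complex.re_le_norm _).trans h
      have h4 : (w ^ 2 + (s : ℂ) ^ 2).re = w.re ^ 2 - w.im ^ 2 + s ^ 2 := by
        simp [pow_two]
      linarith
    have hb : s ^ 2 - e ≤ w.im * s := by
      refine abs_le_of_sq_le_sq' (a := s ^ 2 - e) (b := w.im * s) ?_ (by positivity) |>.2
      nlinarith [sq_nonneg w.re, sq_nonneg s]
    have h5 : (s ^ 2 - e) / (s * (s ^ 2 + e)) ≤ w.im / Complex.normSq w := by
      rw [div_le_div_iff₀ (by positivity) hN]
      have : (s ^ 2 - e) * Complex.normSq w ≤ (s ^ 2 - e) * (s ^ 2 + e) :=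
        mul_le_mul_of_nonneg_left hN2 (by nlinarith)
      have h6 : (s ^ 2 - e) * (s ^ 2 + e) ≤ w.im * s * (s ^ 2 + e) :=
        mul_le_mul_of_nonneg_right hb (by positivity)
      linarith
    have h7 : 1 / s - 2 * e / s ^ 3 ≤ (s ^ 2 - e) / (s * (s ^ 2 + e)) := by
      rw [div_sub_div _ _ hs.ne' (by positivity), div_le_div_iff₀ (by positivity) (by positivity)]
      have : 0 ≤ s ^ 3 * e ^ 2 := by positivity
      nlinarith
    linarith

/-- The density of the Poisson smoothing of `μ` at height `y`. -/
noncomputable def poissonSmoothing (μ : Measure ℝ) (y x : ℝ) : ℝ :=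
  ∫ t, poissonKernelAt y (x - t) ∂μ

lemma poissonSmoothing_nonneg (μ : Measure ℝ) {y : ℝ} (hy : 0 < y) (x : ℝ) :
    0 ≤ poissonSmoothing μ y x :=
  integral_nonneg fun _ => poissonKernelAt_nonneg hy _

section Smoothing

variable (μ : Measure ℝ) [IsProbabilityMeasure μ] {y : ℝ}

lemma integrable_poissonKernelAt_sub_prod (hy : 0 < y) :
    Integrable (fun q : ℝ × ℝ => poissonKernelAt y (q.1 - q.2)) (volume.prod μ) := by
  have hc := continuous_poissonKernelAt hy
  rw [integrable_prod_iff' (Continuous.aestronglyMeasurable (by fun_prop))]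
  refine ⟨Eventually.of_forall fun t => (integrable_poissonKernelAt hy).comp_sub_right t, ?_⟩
  have : ∀ t : ℝ, ∫ x, ‖poissonKernelAt y (x - t)‖ = 1 := by
    intro t
    simp only [Real.norm_of_nonneg (poissonKernelAt_nonneg hy _)]
    rw [integral_sub_right_eq_self (poissonKernelAt y) t, integral_poissonKernelAt hy]
  simp only [this]
  exact integrable_const _

lemma integrable_poissonSmoothing (hy : 0 < y) : Integrable (poissonSmoothing μ y) :=
  (integrable_poissonKernelAt_sub_prod μ hy).integral_prod_left

lemma integral_poissonSmoothing (hy : 0 < y) : ∫ x, poissonSmoothing μ y x = 1 := by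
  unfold poissonSmoothing
  rw [integral_integral_swap (integrable_poissonKernelAt_sub_prod μ hy)]
  simp [integral_sub_right_eq_self (poissonKernelAt y), integral_poissonKernelAt hy]

lemma setIntegral_poissonSmoothing (hy : 0 < y) (b : ℝ) :
    ∫ x in Iic b, poissonSmoothing μ y x = ∫ u, poissonKernelAt y u * cdfOf μ (b - u) := by
  have hc := continuous_poissonKernelAt hy
  have h1 : ∫ x in Iic b, poissonSmoothing μ y x
      = ∫ t, (∫ x in Iic b, poissonKernelAt y (x - t)) ∂μ := by
    unfold poissonSmoothing
    refine integral_integral_swap ?_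
    have := (integrable_poissonKernelAt_sub_prod μ hy).restrict (s := Iic b ×ˢ univ)
    rwa [← Measure.prod_restrict, Measure.restrict_univ] at this
  have h2 : ∀ t, ∫ x in Iic b, poissonKernelAt y (x - t)
      = ∫ u, (Iic (b - u)).indicator (fun _ => poissonKernelAt y u) t := by
    intro t
    rw [← integral_indicator measurableSet_Iic, ← integral_add_right_eq_self _ t]
    congr 1
    ext u
    simp only [indicator, mem_Iic, add_sub_cancel_right]
    congr 1
    exact propext ⟨fun h => by linarith, fun h => by linarith⟩
  have hset : MeasurableSet {q : ℝ × ℝ | q.1 ≤ b - q.2} :=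
    measurableSet_le measurable_fst (by fun_prop)
  have hi : Integrable (Function.uncurry fun t u =>
      (Iic (b - u)).indicator (fun _ => poissonKernelAt y u) t) (μ.prod volume) := by
    have h3 : Integrable (fun q : ℝ × ℝ => poissonKernelAt y q.2) (μ.prod volume) :=
      (integrable_poissonKernelAt hy).comp_snd μ
    refine (h3.indicator hset).congr (Eventually.of_forall fun q => ?_)
    simp [Function.uncurry, indicator]
  rw [h1]
  simp only [h2]
  rw [integral_integral_swap hi]
  congr 1
  ext u
  rw [integral_indicator measurableSet_Iic, setIntegral_const, smul_eq_mul, mul_comm]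
  rfl

end Smoothing

/-- The density of the arcsine distribution. -/
noncomputable def arcsineDensity (x : ℝ) : ℝ := (Real.pi * √(2 - x ^ 2))⁻¹

/-- The distribution function of the arcsine distribution. -/
noncomputable def arcsineCdf (x : ℝ) : ℝ := 1 / 2 + Real.arcsin (x / √2) / Real.pi

lemma arcsineDensity_nonneg (x : ℝ) : 0 ≤ arcsineDensity x := by
  have := Real.pi_pos
  unfold arcsineDensity; positivity

lemma arcsineDensity_eq_zero {x : ℝ} (hx : 2 ≤ x ^ 2) : arcsineDensity x = 0 := by
  rw [arcsineDensity, Real.sqrt_eq_zero_of_nonpos (by linarith)]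
  simp

lemma continuous_arcsineCdf : Continuous arcsineCdf := by
  have := Real.continuous_arcsin
  unfold arcsineCdf
  fun_prop

lemma arcsineCdf_neg (x : ℝ) : arcsineCdf (-x) = 1 - arcsineCdf x := by
  unfold arcsineCdf
  rw [neg_div, Real.arcsin_neg]
  ring

lemma arcsineCdf_of_le {x : ℝ} (hx : x ≤ -√2) : arcsineCdf x = 0 := by
  have h : x / √2 ≤ -1 := by rw [div_le_iff₀ (by positivity)]; linarith
  rw [arcsineCdf, Real.arcsin_of_le_neg_one h]
  have := Real.pi_pos
  field_simp
  norm_num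

lemma arcsineCdf_of_ge {x : ℝ} (hx : √2 ≤ x) : arcsineCdf x = 1 := by
  have := arcsineCdf_neg x
  rw [arcsineCdf_of_le (by linarith)] at this
  linarith

lemma arcsineCdf_mem_Icc (x : ℝ) : arcsineCdf x ∈ Icc (0 : ℝ) 1 := by
  have hpi := Real.pi_pos
  have h1 := Real.arcsin_le_pi_div_two (x / √2)
  have h2 := Real.neg_pi_div_two_le_arcsin (x / √2)
  unfold arcsineCdf
  constructor
  · have : -(1 / 2) ≤ Real.arcsin (x / √2) / Real.pi := by
      rw [le_div_iff₀ hpi]; linarith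
    linarith
  · have : Real.arcsin (x / √2) / Real.pi ≤ 1 / 2 := by
      rw [div_le_iff₀ hpi]; linarith
    linarith

lemma sq_sub_le_sin_sub_sin {a b : ℝ} (ha : -(Real.pi / 2) ≤ a) (hab : a ≤ b)
    (hb : b ≤ Real.pi / 2) : 2 * ((b - a) / Real.pi) ^ 2 ≤ Real.sin b - Real.sin a := by
  have hpi := Real.pi_pos
  rw [Real.sin_sub_sin]
  have h1 : 2 / Real.pi * ((b - a) / 2) ≤ Real.sin ((b - a) / 2) :=
    Real.mul_le_sin (by linarith) (by linarith)
  have h2 : Real.sin ((b - a) / 2) ≤ Real.cos ((b + a) / 2) := by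
    rw [← Real.cos_pi_div_two_sub, ← Real.cos_abs ((b + a) / 2)]
    refine Real.cos_le_cos_of_nonneg_of_le_pi (abs_nonneg _) (by linarith) ?_
    rw [abs_le]
    constructor <;> linarith
  have h3 : 2 / Real.pi * ((b - a) / 2) = (b - a) / Real.pi := by field_simp
  rw [h3] at h1
  have h4 : 0 ≤ (b - a) / Real.pi := div_nonneg (by linarith) hpi.le
  nlinarith

lemma sin_arcsin_sub_sin_arcsin_le {a b : ℝ} (hab : a ≤ b) :
    Real.sin (Real.arcsin b) - Real.sin (Real.arcsin a) ≤ b - a := by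
  have key : ∀ x : ℝ, Real.sin (Real.arcsin x) = max (-1) (min 1 x) := by
    intro x
    rcases le_total x (-1) with h | h
    · rw [Real.arcsin_of_le_neg_one h, Real.sin_neg, Real.sin_pi_div_two,
        min_eq_right (by linarith), max_eq_left h]
    rcases le_total 1 x with h' | h'
    · rw [Real.arcsin_of_one_le h', Real.sin_pi_div_two, min_eq_left h']
      norm_num
    · rw [Real.sin_arcsin h h', min_eq_right h', max_eq_right h]
  rw [key, key]
  rcases max_cases (-1) (min 1 a) with h1 | h1 <;> rcases max_cases (-1) (min 1 b) with h2 | h2 <;>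
  rcases min_cases 1 a with h3 | h3 <;> rcases min_cases 1 b with h4 | h4 <;> linarith

/-- The arcsine distribution function is Hölder continuous of exponent `1/2`. -/
lemma abs_arcsineCdf_sub_le (x x' : ℝ) : |arcsineCdf x - arcsineCdf x'| ≤ √|x - x'| := by
  wlog h : x' ≤ x generalizing x x'
  · rw [abs_sub_comm, abs_sub_comm x]
    exact this x' x (le_of_not_ge h)
  have hpi := Real.pi_pos
  have h2 : (1 : ℝ) ≤ √2 := Real.one_le_sqrt.2 (by norm_num)
  have hd : x' / √2 ≤ x / √2 := by gcongr
  have h3 := sin_arcsin_sub_sin_arcsin_le hd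
  have h4 := sq_sub_le_sin_sub_sin (Real.neg_pi_div_two_le_arcsin (x' / √2))
    (Real.monotone_arcsin hd) (Real.arcsin_le_pi_div_two (x / √2))
  have e : arcsineCdf x - arcsineCdf x'
      = (Real.arcsin (x / √2) - Real.arcsin (x' / √2)) / Real.pi := by
    unfold arcsineCdf; ring
  have h5 : x / √2 - x' / √2 ≤ x - x' := by
    rw [← sub_div]
    exact div_le_self (by linarith) h2
  rw [abs_of_nonneg (sub_nonneg.2 h)]
  refine Real.abs_le_sqrt ?_
  rw [e]
  nlinarith [sq_nonneg ((Real.arcsin (x / √2) - Real.arcsin (x' / √2)) / Real.pi)]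

lemma hasDerivWithinAt_arcsineCdf {x : ℝ} (hx : x ≠ -√2) :
    HasDerivWithinAt arcsineCdf (arcsineDensity x) (Ioi x) x := by
  have h2 : (0 : ℝ) < √2 := by positivity
  have hx' : x / √2 ≠ -1 := by
    rw [Ne, div_eq_iff h2.ne']; simpa using hx
  have h1 : HasDerivWithinAt (fun u : ℝ => u / √2) (1 / √2) (Ioi x) x :=
    ((hasDerivAt_id x).div_const _).hasDerivWithinAt
  have hm : MapsTo (fun u : ℝ => u / √2) (Ioi x) (Ici (x / √2)) := fun u hu =>
    (div_lt_div_of_pos_right hu h2).le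
  have h3 := (((Real.hasDerivWithinAt_arcsin_Ici hx').comp x h1 hm).div_const
    Real.pi).const_add (1 / 2)
  refine h3.congr_deriv ?_
  unfold arcsineDensity
  have e : 2 - x ^ 2 = 2 * (1 - (x / √2) ^ 2) := by
    rw [div_pow, Real.sq_sqrt (by norm_num)]; ring
  rw [e, Real.sqrt_mul (by norm_num)]
  rw [mul_inv, mul_inv]
  ring

lemma intervalIntegrable_arcsineDensity {b : ℝ} (hb : -√2 ≤ b) :
    IntervalIntegrable arcsineDensity volume (-√2) b := by
  rw [intervalIntegrable_iff_integrableOn_Ioc_of_le hb]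
  exact intervalIntegral.integrableOn_deriv_right_of_nonneg continuous_arcsineCdf.continuousOn
    (fun x hx => hasDerivWithinAt_arcsineCdf hx.1.ne') fun x _ => arcsineDensity_nonneg x

lemma intervalIntegral_arcsineDensity {b : ℝ} (hb : -√2 ≤ b) :
    ∫ x in (-√2)..b, arcsineDensity x = arcsineCdf b := by
  rw [intervalIntegral.integral_eq_sub_of_hasDeriv_right_of_le hb
    continuous_arcsineCdf.continuousOn (fun x hx => hasDerivWithinAt_arcsineCdf hx.1.ne')
    (intervalIntegrable_arcsineDensity hb), arcsineCdf_of_le le_rfl, sub_zero]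

lemma two_le_sq_of_sqrt_two_le_abs {x : ℝ} (hx : √2 ≤ |x|) : 2 ≤ x ^ 2 := by
  rw [← sq_abs, ← Real.sqrt_le_left (abs_nonneg x)]
  exact hx

lemma integrable_arcsineDensity : Integrable arcsineDensity := by
  have h2 : (0 : ℝ) < √2 := by positivity
  have h := (intervalIntegrable_iff_integrableOn_Ioc_of_le (by linarith)).1
    (intervalIntegrable_arcsineDensity (b := √2) (by linarith))
  refine (integrableOn_iff_integrable_of_support_subset fun x hx => ?_).1 h
  by_contra hx'
  refine hx (arcsineDensity_eq_zero (two_le_sq_of_sqrt_two_le_abs ?_))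
  rw [mem_Ioc, not_and_or, not_lt, not_le] at hx'
  rcases hx' with h | h
  · exact le_abs.2 (Or.inr (by linarith))
  · exact le_abs.2 (Or.inl h.le)

lemma setIntegral_Iic_arcsineDensity (b : ℝ) :
    ∫ x in Iic b, arcsineDensity x = arcsineCdf b := by
  have h2 : (0 : ℝ) < √2 := by positivity
  have hz : ∀ c ≤ -√2, ∫ x in Iic c, arcsineDensity x = 0 := by
    intro c hc
    refine setIntegral_eq_zero_of_forall_eq_zero fun x hx => arcsineDensity_eq_zero ?_
    refine two_le_sq_of_sqrt_two_le_abs (le_abs.2 (Or.inr ?_))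
    have : x ≤ c := hx
    linarith
  rcases le_total b (-√2) with hb | hb
  · rw [hz b hb, arcsineCdf_of_le hb]
  · rw [← intervalIntegral_arcsineDensity hb, ← Iic_union_Ioc_eq_Iic hb,
      setIntegral_union (Iic_disjoint_Ioc le_rfl) measurableSet_Ioc
        integrable_arcsineDensity.integrableOn integrable_arcsineDensity.integrableOn,
      hz _ le_rfl, zero_add, intervalIntegral.integral_of_le hb]

lemma integral_arcsineDensity : ∫ x, arcsineDensity x = 1 := by
  have h2 : (0 : ℝ) < √2 := by positivity
  rw [← setIntegral_eq_integral_of_forall_compl_eq_zero (s := Iic (√2)) fun x hx =>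
    arcsineDensity_eq_zero (two_le_sq_of_sqrt_two_le_abs (le_abs.2 (Or.inl ?_)))]
  · rw [setIntegral_Iic_arcsineDensity, arcsineCdf_of_ge le_rfl]
  · exact (not_le.1 hx).le

lemma cdfOf_arcsine (x : ℝ) : cdfOf arcsine x = arcsineCdf x := by
  have e : (fun t : ℝ => ENNReal.ofReal (if t ^ 2 < 2 then (Real.pi * √(2 - t ^ 2))⁻¹ else 0))
      = fun t => ENNReal.ofReal (arcsineDensity t) := by
    ext t
    split_ifs with h
    · rfl
    · rw [arcsineDensity_eq_zero (not_lt.1 h)]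
  rw [cdfOf, arcsine, e, withDensity_apply _ measurableSet_Iic,
    ← setIntegral_Iic_arcsineDensity,
    integral_eq_lintegral_of_nonneg_ae (Eventually.of_forall arcsineDensity_nonneg)
      integrable_arcsineDensity.aestronglyMeasurable.restrict]

lemma integral_inv_sqrt_pow_three {a r : ℝ} (hr : 0 < r) (ha : 0 ≤ a)
    (har : a ^ 2 + r ^ 2 = 2) :
    IntervalIntegrable (fun x : ℝ => (√(2 - x ^ 2) ^ 3)⁻¹) volume (-a) a ∧
      ∫ x in (-a)..a, (√(2 - x ^ 2) ^ 3)⁻¹ = a / r := by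
  have hpos : ∀ x ∈ uIcc (-a) a, 0 < 2 - x ^ 2 := by
    intro x hx
    rw [uIcc_of_le (by linarith)] at hx
    have : 0 < r ^ 2 := by positivity
    nlinarith [hx.1, hx.2]
  have hi : IntervalIntegrable (fun x : ℝ => (√(2 - x ^ 2) ^ 3)⁻¹) volume (-a) a := by
    refine ContinuousOn.intervalIntegrable (ContinuousOn.inv₀ (by fun_prop) fun x hx => ?_)
    have := Real.sqrt_pos.2 (hpos x hx)
    positivity
  refine ⟨hi, ?_⟩
  have hd : ∀ x ∈ uIcc (-a) a,
      HasDerivAt (fun x : ℝ => x / (2 * √(2 - x ^ 2))) ((√(2 - x ^ 2) ^ 3)⁻¹) x := by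
    intro x hx
    have h0 := hpos x hx
    have hs := Real.sqrt_pos.2 h0
    have hsq := Real.sq_sqrt h0.le
    have h1 := (((hasDerivAt_pow 2 x).const_sub 2).sqrt h0.ne').const_mul 2
    refine ((hasDerivAt_id x).div h1 (by positivity)).congr_deriv ?_
    simp only [id, Nat.cast_ofNat]
    set s := √(2 - x ^ 2)
    field_simp
    norm_num
    linear_combination hsq
  rw [intervalIntegral.integral_eq_sub_of_hasDerivAt hd hi]
  have e : √(2 - a ^ 2) = r := by
    rw [show 2 - a ^ 2 = r ^ 2 by linarith, Real.sqrt_sq hr.le]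
  rw [neg_sq, e]
  field_simp
  ring

/-- A probability density which, up to an error of order `r ^ 2 / (2 - x ^ 2) ^ (3 / 2)`,
dominates the arcsine density has a distribution function close to the arcsine one. -/
lemma abs_setIntegral_sub_arcsineCdf_le {p : ℝ → ℝ} {r : ℝ} (hr : 0 < r) (hr1 : r ≤ 1)
    (hp0 : ∀ x, 0 ≤ p x) (hpi : Integrable p) (hp1 : ∫ x, p x = 1)
    (hp : ∀ x : ℝ, x ^ 2 < 2 →
      arcsineDensity x - p x ≤ 2 * r ^ 2 / Real.pi * (√(2 - x ^ 2) ^ 3)⁻¹) (b : ℝ) :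
    |(∫ x in Iic b, p x) - arcsineCdf b| ≤ 3 * r := by
  have hπ := Real.pi_gt_three
  set a := √(2 - r ^ 2) with ha
  have ha0 : 0 ≤ a := Real.sqrt_nonneg _
  have har : a ^ 2 + r ^ 2 = 2 := by
    rw [ha, Real.sq_sqrt (by nlinarith)]; ring
  have h2 : (√2) ^ 2 = 2 := Real.sq_sqrt (by norm_num)
  have h2' : 1 ≤ √2 := Real.one_le_sqrt.2 (by norm_num)
  have ha2 : a ≤ √2 := Real.sqrt_le_sqrt (by nlinarith)
  obtain ⟨hsi, hsv⟩ := integral_inv_sqrt_pow_three hr ha0 har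
  have hqi := integrable_arcsineDensity
  set C := 2 * r ^ 2 / Real.pi with hC
  have hC0 : 0 ≤ C := by positivity
  set φ : ℝ → ℝ := fun x => (Ioc (-a) a)ᶜ.indicator arcsineDensity x +
    (Ioc (-a) a).indicator (fun x => C * (√(2 - x ^ 2) ^ 3)⁻¹) x with hφ
  have hsi' : IntegrableOn (fun x => C * (√(2 - x ^ 2) ^ 3)⁻¹) (Ioc (-a) a) :=
    ((intervalIntegrable_iff_integrableOn_Ioc_of_le (by linarith)).1 hsi).const_mul C
  have hm : MeasurableSet (Ioc (-a) a) := measurableSet_Ioc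
  have hφi : Integrable φ := (hqi.indicator hm.compl).add (hsi'.integrable_indicator hm)
  have hφ0 : ∀ x, 0 ≤ φ x := fun x => add_nonneg
    (indicator_nonneg (fun x _ => arcsineDensity_nonneg x) x)
    (indicator_nonneg (fun x _ => by positivity) x)
  have hle : ∀ x, arcsineDensity x - p x ≤ φ x := by
    intro x
    by_cases hx : x ∈ Ioc (-a) a
    · simp only [hφ, indicator_of_mem hx, indicator_of_notMem (notMem_compl_iff.2 hx), zero_add]
      refine hp x ?_
      have : 0 < r ^ 2 := by positivity
      nlinarith [hx.1, hx.2]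
    · simp only [hφ, indicator_of_notMem hx, indicator_of_mem (mem_compl hx), add_zero]
      linarith [hp0 x]
  have hφv : ∫ x, φ x ≤ 3 * r := by
    have e1 : ∫ x in Ioc (-a) a, arcsineDensity x = arcsineCdf a - arcsineCdf (-a) := by
      rw [← setIntegral_Iic_arcsineDensity a, ← setIntegral_Iic_arcsineDensity (-a),
        ← intervalIntegral.integral_of_le (by linarith),
        ← intervalIntegral.integral_Iic_sub_Iic hqi.integrableOn hqi.integrableOn]
    have e2 := integral_add_compl hm hqi
    rw [e1, integral_arcsineDensity, arcsineCdf_neg] at e2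
    have e3 : ∫ x in Ioc (-a) a, C * (√(2 - x ^ 2) ^ 3)⁻¹ = C * (a / r) := by
      rw [integral_const_mul, ← intervalIntegral.integral_of_le (by linarith), hsv]
    rw [hφ, integral_add (hqi.indicator hm.compl) (hsi'.integrable_indicator hm),
      integral_indicator hm.compl, integral_indicator hm, e3]
    have e4 : arcsineCdf (√2) - arcsineCdf a ≤ r := by
      refine (le_abs_self _).trans ((abs_arcsineCdf_sub_le _ _).trans (Real.sqrt_le_iff.2
        ⟨hr.le, ?_⟩))
      rw [abs_of_nonneg (by linarith)]
      nlinarith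
    rw [arcsineCdf_of_ge le_rfl] at e4
    have e5 : C * (a / r) ≤ r := by
      have : C * (a / r) = r * (2 * a / Real.pi) := by rw [hC]; field_simp
      rw [this]
      refine mul_le_of_le_one_right hr.le ?_
      rw [div_le_one (by linarith)]
      nlinarith
    linarith
  have hb : ∀ s : Set ℝ, ∫ x in s, (arcsineDensity x - p x) ≤ 3 * r := fun s =>
    calc _ ≤ ∫ x in s, φ x :=
          setIntegral_mono (hqi.sub hpi).integrableOn hφi.integrableOn hle
      _ ≤ ∫ x, φ x := setIntegral_le_integral hφi (Eventually.of_forall hφ0)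
      _ ≤ _ := hφv
  have h1 := hb (Iic b)
  have h3 := hb (Iic b)ᶜ
  rw [integral_sub hqi.integrableOn hpi.integrableOn] at h1 h3
  have h4 := integral_add_compl (measurableSet_Iic (a := b)) hqi
  have h5 := integral_add_compl (measurableSet_Iic (a := b)) hpi
  rw [integral_arcsineDensity] at h4
  rw [setIntegral_Iic_arcsineDensity] at h1 h4
  rw [hp1] at h5
  rw [abs_le]
  constructor <;> linarith

lemma cdfOf_monotone (μ : Measure ℝ) [IsFiniteMeasure μ] : Monotone (cdfOf μ) := fun _ _ h =>
  measureReal_mono (Iic_subset_Iic.2 h)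

lemma cdfOf_mem_Icc (μ : Measure ℝ) [IsProbabilityMeasure μ] (x : ℝ) :
    cdfOf μ x ∈ Icc (0 : ℝ) 1 :=
  ⟨ENNReal.toReal_nonneg, measureReal_le_one⟩

/-- The Poisson smoothing of `μ` is read off from the reciprocal Cauchy transform of `μ`. -/
lemma poissonSmoothing_eq_of_cauchy (μ : Measure ℝ) [IsProbabilityMeasure μ] {x y : ℝ}
    (hy : 0 < y) {w : ℂ} (hw : ∫ t, ((x + y * I : ℂ) - (t : ℂ))⁻¹ ∂μ = w⁻¹) :
    poissonSmoothing μ y x = Real.pi⁻¹ * (w.im / Complex.normSq w) := by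
  have him : (x + y * I : ℂ).im = y := by simp
  have hre : (x + y * I : ℂ).re = x := by simp
  have h := im_integral_ofReal_sub_inv μ (z := x + y * I) (by rwa [him])
  have e : ∫ t, ((t : ℂ) - (x + y * I))⁻¹ ∂μ = -w⁻¹ := by
    rw [← hw, ← integral_neg]
    congr 1
    ext t
    rw [← inv_neg, neg_sub]
  rw [e, him, hre, Complex.neg_im, Complex.inv_im, neg_div, neg_neg] at h
  rw [h, poissonSmoothing, ← integral_const_mul]
  congr 1
  ext t
  rw [poissonKernelAt, div_mul_eq_div_div_swap, div_eq_inv_mul _ Real.pi]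

/-- The rescaled iterate of the `F`-transform approximately squares to `x ^ 2 - 2` close to the
real axis. -/
lemma rescaled_iterate_sq_add_le {ν : Measure ℝ} [IsProbabilityMeasure ν]
    (hint : Integrable (fun t => |t|) ν) {F : ℂ → ℂ}
    (hF : ∀ z : ℂ, F z = z + ∫ t, ((t : ℂ) - z)⁻¹ ∂ν) {n : ℕ} (hn : 1 ≤ n) {x y : ℝ}
    (hy : 0 < y) (hx : |x| ≤ 1.415) {w : ℂ}
    (hw : w = F^[n] ((√n : ℂ) * (x + y * I)) / (√n : ℂ)) :
    0 < w.im ∧ ‖w ^ 2 + 2 - x ^ 2‖ ≤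
      2 * (∫ t, |t| ∂ν) / (√n * y) + 1 / (n * y ^ 2) + (2.83 * y + y ^ 2) := by
  have hn0 : (0 : ℝ) < n := by exact_mod_cast hn
  have hs : 0 < √(n : ℝ) := Real.sqrt_pos.2 hn0
  have hsn : (√(n : ℝ)) ^ 2 = n := Real.sq_sqrt hn0.le
  have hsnC : ((√(n : ℝ) : ℝ) : ℂ) ^ 2 = n := by exact_mod_cast hsn
  have hsC : ((√(n : ℝ) : ℝ) : ℂ) ≠ 0 := by exact_mod_cast hs.ne'
  have hnC : (n : ℂ) ≠ 0 := by exact_mod_cast hn0.ne'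
  set Z : ℂ := (√n : ℂ) * (x + y * I) with hZ
  have hZim : Z.im = √n * y := by simp [hZ]
  have hZpos : 0 < Z.im := by rw [hZim]; positivity
  obtain ⟨h1, h2⟩ := iterate_sq_approx hint hF hZpos n
  set W := F^[n] Z
  have hwim : w.im = W.im / √n := by rw [hw, Complex.div_ofReal_im]
  refine ⟨by rw [hwim]; exact div_pos (hZpos.trans_le h1) hs, ?_⟩
  have e : w ^ 2 + 2 - x ^ 2 = (W ^ 2 - Z ^ 2 + 2 * n) / n + (2 * x * y * I - y ^ 2) := by
    rw [hw, hZ, div_pow, mul_pow, hsnC]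
    field_simp
    linear_combination (n * (y : ℂ) ^ 2) * I_sq
  have h3 : ‖(W ^ 2 - Z ^ 2 + 2 * n) / (n : ℂ)‖
      ≤ 2 * (∫ t, |t| ∂ν) / (√n * y) + 1 / (n * y ^ 2) := by
    rw [norm_div, Complex.norm_natCast, div_le_iff₀ hn0]
    refine h2.trans_eq ?_
    rw [hZim, mul_pow, hsn, mul_comm]
  have h4 : ‖(2 * x * y * I - y ^ 2 : ℂ)‖ ≤ 2.83 * y + y ^ 2 := by
    refine (norm_sub_le _ _).trans ?_
    simp only [norm_mul, norm_pow, Complex.norm_real, Complex.norm_I, Complex.norm_ofNat,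
      Real.norm_eq_abs, abs_of_pos hy, mul_one]
    nlinarith
  rw [e]
  exact (norm_add_le _ _).trans (add_le_add h3 h4)

/-- The Berry–Esseen bound in terms of the parameter `η` with `c = η ^ 4 * √n`. -/
lemma abs_cdfOf_sub_le_of_small {ν : Measure ℝ} [IsProbabilityMeasure ν]
    (hint : Integrable (fun t => |t|) ν) {F : ℂ → ℂ}
    (hF : ∀ z : ℂ, F z = z + ∫ t, ((t : ℂ) - z)⁻¹ ∂ν) (μ : Measure ℝ) [IsProbabilityMeasure μ]
    {n : ℕ} (hn : 1 ≤ n)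
    (hcauchy : ∀ z : ℂ, 0 < z.im →
      ∫ t, (z - (t : ℂ))⁻¹ ∂μ = (√n : ℂ) / F^[n] ((√n : ℂ) * z))
    {η : ℝ} (hη : 0 < η) (hη1 : η ≤ 1 / 71) (hc : ∫ t, |t| ∂ν = η ^ 4 * √n)
    (hηn : 1 ≤ 8 * η ^ 6 * n) (x : ℝ) :
    |cdfOf μ x - cdfOf arcsine x| ≤ 71 * η := by
  have hn0 : (0 : ℝ) < n := by exact_mod_cast hn
  have hs : 0 < √(n : ℝ) := Real.sqrt_pos.2 hn0
  have hπ := Real.pi_pos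
  set y := 2 * η ^ 2 with hydef
  have hy : 0 < y := by positivity
  have hdens : ∀ x : ℝ, x ^ 2 < 2 → arcsineDensity x - poissonSmoothing μ y x
      ≤ 2 * (3 * η) ^ 2 / Real.pi * (√(2 - x ^ 2) ^ 3)⁻¹ := by
    intro x hx
    have hsx : 0 < √(2 - x ^ 2) := Real.sqrt_pos.2 (by linarith)
    obtain ⟨hwim, hw⟩ := rescaled_iterate_sq_add_le hint hF hn hy
      (abs_le_of_sq_le_sq (by norm_num; linarith) (by norm_num)) (x := x) rfl
    set w := F^[n] ((√n : ℂ) * (x + y * I)) / (√n : ℂ) with hwdef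
    have hG : ∫ t, ((x + y * I : ℂ) - (t : ℂ))⁻¹ ∂μ = w⁻¹ := by
      rw [hcauchy _ (by simpa using hy), hwdef, inv_div]
    have he : ‖w ^ 2 + ((√(2 - x ^ 2) : ℝ) : ℂ) ^ 2‖ ≤ (3 * η) ^ 2 := by
      have e : w ^ 2 + ((√(2 - x ^ 2) : ℝ) : ℂ) ^ 2 = w ^ 2 + 2 - x ^ 2 := by
        rw [← Complex.ofReal_pow, Real.sq_sqrt (by linarith)]
        push_cast; ring
      rw [e]
      refine hw.trans ?_
      have h1 : 2 * (∫ t, |t| ∂ν) / (√n * y) = η ^ 2 := by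
        rw [hc, hydef]; field_simp
      have h2 : 1 / (n * y ^ 2) ≤ 2 * η ^ 2 := by
        rw [div_le_iff₀ (by positivity), hydef]
        nlinarith
      rw [h1, hydef]
      nlinarith [mul_pos hη hη, mul_le_mul hη1 hη1 hη.le (by norm_num)]
    have h := inv_sub_im_div_normSq_le hsx hwim he
    rw [poissonSmoothing_eq_of_cauchy μ hy hG]
    have h' := mul_le_mul_of_nonneg_left h (inv_nonneg.2 hπ.le)
    have e1 : arcsineDensity x = Real.pi⁻¹ * (1 / √(2 - x ^ 2)) := by
      rw [arcsineDensity, mul_inv, one_div]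
    rw [e1, ← mul_sub]
    refine h'.trans_eq ?_
    ring
  have hδ : ∀ b, |(∫ u, poissonKernelAt y u * cdfOf μ (b - u)) - arcsineCdf b| ≤ 3 * (3 * η) := by
    intro b
    rw [← setIntegral_poissonSmoothing μ hy]
    exact abs_setIntegral_sub_arcsineCdf_le (by positivity) (by linarith)
      (poissonSmoothing_nonneg μ hy) (integrable_poissonSmoothing μ hy)
      (integral_poissonSmoothing μ hy) hdens b
  have hmain := abs_sub_le_of_poisson_smoothing hy (cdfOf_monotone μ) (cdfOf_mem_Icc μ)
    arcsineCdf_mem_Icc abs_arcsineCdf_sub_le continuous_arcsineCdf.measurable hδ x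
  rw [cdfOf_arcsine]
  refine hmain.trans ?_
  have h1 : √y ≤ 3 / 2 * η := Real.sqrt_le_iff.2 ⟨by positivity, by rw [hydef]; nlinarith⟩
  have h3 : √3 ≤ 2 := Real.sqrt_le_iff.2 ⟨by norm_num, by norm_num⟩
  have h2 : √(2 * (√3 * y)) ≤ 3 * η :=
    Real.sqrt_le_iff.2 ⟨by positivity, by rw [hydef]; nlinarith [sq_nonneg η]⟩
  linarith

/-- Berry–Esseen type estimate for the monotone CLT, rate `n^{-1/8}`. -/
theorem berry_esseen_monotone_clt
    (ν : Measure ℝ) [IsFiniteMeasure ν] (hν1 : ν Set.univ = 1)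
    (hint : Integrable (fun t => |t|) ν)
    (c : ℝ) (hc : c = ∫ t, |t| ∂ν) (hcpos : 0 < c)
    (F : ℂ → ℂ) (hF : ∀ z : ℂ, F z = z + ∫ t, ((t : ℂ) - z)⁻¹ ∂ν)
    (μ : ℕ → Measure ℝ) (hprob : ∀ n, IsProbabilityMeasure (μ n))
    (hcauchy : ∀ n : ℕ, 1 ≤ n → ∀ z : ℂ, 0 < z.im →
      ∫ t, (z - (t : ℂ))⁻¹ ∂(μ n)
        = (Real.sqrt n : ℂ) / F^[n] ((Real.sqrt n : ℂ) * z))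
    (n : ℕ)
    (hn : max ((8 * Real.sqrt (3 * c)) ^ 4) ((8 * c * Real.sqrt c) ^ (-4 : ℝ)) < (n : ℝ)) :
    ∀ x : ℝ, |cdfOf (μ n) x - cdfOf arcsine x| ≤
      71 * c ^ ((1 : ℝ) / 4) * (n : ℝ) ^ (-(1 : ℝ) / 8) := by
  intro x
  have : IsProbabilityMeasure ν := ⟨hν1⟩
  have := hprob n
  have hn0 : (0 : ℝ) < n := lt_of_le_of_lt (by positivity) ((le_max_left _ _).trans_lt hn)
  have hn1 : 1 ≤ n := by exact_mod_cast hn0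
  set η := c ^ ((1 : ℝ) / 4) * (n : ℝ) ^ (-(1 : ℝ) / 8) with hηdef
  have hη : 0 < η := by positivity
  rw [mul_assoc, ← hηdef]
  rcases le_total η (1 / 71) with hη1 | hη1
  · have hη4 : c = η ^ 4 * √n := by
      rw [hηdef, mul_pow, ← Real.rpow_natCast, ← Real.rpow_natCast, ← Real.rpow_mul hcpos.le,
        ← Real.rpow_mul hn0.le, Real.sqrt_eq_rpow, mul_assoc, ← Real.rpow_add hn0]
      norm_num
    have hηn : 1 ≤ 8 * η ^ 6 * n := by
      have hB : 0 < 8 * c * √c := by positivity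
      have h1 := (le_max_right _ _).trans_lt hn
      rw [Real.rpow_neg hB.le, inv_lt_iff_one_lt_mul₀ (by positivity)] at h1
      have h2 : (8 * c * √c) ^ (4 : ℝ) = (8 * c * √c) ^ 4 := by
        exact_mod_cast Real.rpow_natCast (8 * c * √c) 4
      have h3 : (√c) ^ 2 = c := Real.sq_sqrt hcpos.le
      have h4 : (√(n : ℝ)) ^ 2 = n := Real.sq_sqrt hn0.le
      have h5 : n * (8 * c * √c) ^ 4 = (8 * η ^ 6 * n) ^ 4 := by
        calc n * (8 * c * √c) ^ 4 = n * 8 ^ 4 * c ^ 4 * ((√c) ^ 2) ^ 2 := by ring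
          _ = n * 8 ^ 4 * c ^ 6 := by rw [h3]; ring
          _ = n * 8 ^ 4 * (η ^ 4 * √n) ^ 6 := by rw [← hη4]
          _ = n * 8 ^ 4 * η ^ 24 * ((√n) ^ 2) ^ 3 := by ring
          _ = _ := by rw [h4]; ring
      rw [h2] at h1
      by_contra hlt
      have h6 := pow_le_one₀ (n := 4) (by positivity) (not_le.1 hlt).le
      linarith
    exact abs_cdfOf_sub_le_of_small hint hF (μ n) hn1 (hcauchy n hn1) hη hη1
      (hc ▸ hη4) hηn x
  · rw [cdfOf_arcsine]
    have h1 := cdfOf_mem_Icc (μ n) x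
    have h2 := arcsineCdf_mem_Icc x
    rw [abs_le]
    constructor <;> linarith [h1.1, h1.2, h2.1, h2.2]
end

section
/- Let ν be a finite Borel measure on ℝ with ν(ℝ) = 1, finite mean m(ν) = ∫ t dν(t), finite second moment m₂(ν) = ∫ t² dν(t), and strictly positive first absolute moment c = ∫ |t| dν(t) > 0. Let ρ be a finite Borel measure on ℝ with finite first absolute moment d := ∫ |t| dρ(t) < ∞ such that for all z ∈ ℂ⁺ one has ∫_ℝ (z − t)⁻¹ dν(t) · (z − m(ν) − ∫_ℝ (z − s)⁻¹ dρ(s)) = 1 (the Nevanlinna representation of the F-transform of ν). Define F : ℂ⁺ → ℂ⁺ by F(z) = z + ∫_ℝ (t − z)⁻¹ dν(t), and for each n ≥ 1 let μ_n be a probability measure on ℝ with ∫_ℝ (z − t)⁻¹ dμ_n(t) = √n / F^{∘n}(√n z) for all z ∈ ℂ⁺. Then for every integer n > max{4 m(ν)², 4 m₂(ν)², 12288 · [d + 3(1 + m₂(ν))²]²} one has sup_{x ∈ ℝ} |C_{μ_n}(x) − C_γ(x)| ≤ 200 · √(d + 3(1 + m₂(ν))²) · n^(−1/4). -/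
open MeasureTheory Complex Set Filter

/-- The Cauchy transform of a measure on the real line. -/
noncomputable def cauchyTransform (τ : Measure ℝ) (z : ℂ) : ℂ := ∫ t, (z - (t : ℂ))⁻¹ ∂τ

lemma sub_ofReal_ne_zero {z : ℂ} (hz : 0 < z.im) (t : ℝ) : z - (t : ℂ) ≠ 0 := by
  intro h
  have := congrArg Complex.im h
  simp at this
  linarith

lemma norm_inv_sub_ofReal_le {z : ℂ} (hz : 0 < z.im) (t : ℝ) :
    ‖(z - (t : ℂ))⁻¹‖ ≤ z.im⁻¹ := by
  rw [norm_inv]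
  apply inv_anti₀ hz
  have := Complex.abs_im_le_norm (z - (t : ℂ))
  simp only [sub_im, ofReal_im, sub_zero] at this
  exact (le_abs_self _).trans this

lemma measurable_inv_sub_ofReal (z : ℂ) : Measurable fun t : ℝ => (z - (t : ℂ))⁻¹ := by
  fun_prop

lemma integrable_inv_sub_ofReal (τ : Measure ℝ) [IsFiniteMeasure τ] {z : ℂ} (hz : 0 < z.im) :
    Integrable (fun t : ℝ => (z - (t : ℂ))⁻¹) τ :=
  Integrable.of_bound (measurable_inv_sub_ofReal z).aestronglyMeasurable z.im⁻¹
    (ae_of_all _ (norm_inv_sub_ofReal_le hz))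

lemma integrable_mul_inv_sub_ofReal {τ : Measure ℝ} {f : ℝ → ℝ} (hf : Integrable f τ)
    {z : ℂ} (hz : 0 < z.im) : Integrable (fun t : ℝ => (f t : ℂ) * (z - (t : ℂ))⁻¹) τ :=
  hf.ofReal.mul_bdd (c := z.im⁻¹) (measurable_inv_sub_ofReal z).aestronglyMeasurable
    (ae_of_all _ (norm_inv_sub_ofReal_le hz))

lemma norm_integral_mul_inv_sub_ofReal_le {τ : Measure ℝ} {f : ℝ → ℝ} (hf : Integrable f τ)
    {z : ℂ} (hz : 0 < z.im) :
    ‖∫ t, (f t : ℂ) * (z - (t : ℂ))⁻¹ ∂τ‖ ≤ (∫ t, |f t| ∂τ) / z.im := by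
  rw [div_eq_mul_inv, ← integral_mul_const]
  refine norm_integral_le_of_norm_le (hf.abs.mul_const _) (ae_of_all _ fun t => ?_)
  rw [norm_mul, Complex.norm_real, Real.norm_eq_abs]
  exact mul_le_mul_of_nonneg_left (norm_inv_sub_ofReal_le hz t) (abs_nonneg _)

lemma im_cauchyTransform (τ : Measure ℝ) [IsFiniteMeasure τ] {z : ℂ} (hz : 0 < z.im) :
    (cauchyTransform τ z).im = ∫ t, -(z.im / ((z.re - t) ^ 2 + z.im ^ 2)) ∂τ := by
  have h := integral_im (integrable_inv_sub_ofReal τ hz)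
  simp only [RCLike.im_eq_complex_im] at h
  rw [cauchyTransform, ← h]
  congr 1 with t
  simp [Complex.inv_im, Complex.normSq_apply, neg_div, pow_two]

lemma im_cauchyTransform_nonpos (τ : Measure ℝ) [IsFiniteMeasure τ] {z : ℂ} (hz : 0 < z.im) :
    (cauchyTransform τ z).im ≤ 0 := by
  rw [im_cauchyTransform τ hz]
  exact integral_nonpos fun t => neg_nonpos.2 (by positivity)

lemma norm_cauchyTransform_le (τ : Measure ℝ) [IsProbabilityMeasure τ] {z : ℂ} (hz : 0 < z.im) :
    ‖cauchyTransform τ z‖ ≤ z.im⁻¹ := by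
  have := norm_integral_le_of_norm_le_const (μ := τ)
    (ae_of_all _ (norm_inv_sub_ofReal_le hz))
  simpa [cauchyTransform] using this

lemma mul_cauchyTransform (τ : Measure ℝ) [IsProbabilityMeasure τ] (h1 : Integrable (fun t => t) τ)
    {z : ℂ} (hz : 0 < z.im) :
    z * cauchyTransform τ z = 1 + ∫ t, (t : ℂ) * (z - (t : ℂ))⁻¹ ∂τ := by
  have h : ∀ t : ℝ, z * (z - (t : ℂ))⁻¹ = 1 + (t : ℂ) * (z - (t : ℂ))⁻¹ := fun t => by
    field_simp [sub_ofReal_ne_zero hz t]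
    ring
  rw [cauchyTransform, ← integral_const_mul]
  simp_rw [h]
  rw [integral_add (integrable_const _) (integrable_mul_inv_sub_ofReal h1 hz)]
  simp

lemma mul_integral_mul_inv_sub (τ : Measure ℝ) (h1 : Integrable (fun t => t) τ)
    (h2 : Integrable (fun t => t ^ 2) τ) {z : ℂ} (hz : 0 < z.im) :
    z * ∫ t, (t : ℂ) * (z - (t : ℂ))⁻¹ ∂τ =
      ((∫ t, t ∂τ : ℝ) : ℂ) + ∫ t, ((t ^ 2 : ℝ) : ℂ) * (z - (t : ℂ))⁻¹ ∂τ := by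
  have h : ∀ t : ℝ, z * ((t : ℂ) * (z - (t : ℂ))⁻¹) =
      (t : ℂ) + ((t ^ 2 : ℝ) : ℂ) * (z - (t : ℂ))⁻¹ := fun t => by
    push_cast
    field_simp [sub_ofReal_ne_zero hz t]
    ring
  rw [← integral_const_mul]
  simp_rw [h]
  rw [integral_add (f := fun t : ℝ => (t : ℂ)) h1.ofReal (integrable_mul_inv_sub_ofReal h2 hz)]
  congr 1
  exact integral_ofReal

/-- The map `z ↦ z - G(z)` nearly acts as the shift by `-2` on squares. -/
lemma norm_sq_sub_cauchyTransform_le (τ : Measure ℝ) [IsProbabilityMeasure τ]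
    (h1 : Integrable (fun t => t) τ) (h2 : Integrable (fun t => t ^ 2) τ) {z : ℂ}
    (hz : 100 * (1 + ∫ t, t ^ 2 ∂τ) ≤ z.im) :
    ‖(z - cauchyTransform τ z) ^ 2 - z ^ 2 + 2‖ * ‖z‖ ≤ 2 * (1 + ∫ t, t ^ 2 ∂τ) := by
  set s := ∫ t, t ^ 2 ∂τ with hs
  have hs0 : 0 ≤ s := integral_nonneg fun t => sq_nonneg t
  have hz0 : 0 < z.im := by linarith
  have hc : 2 * ∫ t, |t| ∂τ ≤ 1 + s := by
    rw [← integral_const_mul]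
    have : 1 + s = ∫ t, (1 + t ^ 2) ∂τ := by
      rw [integral_add (integrable_const _) h2]; simp [hs]
    rw [this]
    refine integral_mono (h1.abs.const_mul 2) ((integrable_const _).add h2) fun t => ?_
    simp only
    nlinarith [sq_nonneg (|t| - 1), sq_abs t]
  have hm : |∫ t, t ∂τ| ≤ ∫ t, |t| ∂τ := abs_integral_le_integral_abs
  set G := cauchyTransform τ z with hG
  set I := ∫ t, (t : ℂ) * (z - (t : ℂ))⁻¹ ∂τ with hI
  have e1 : z * G = 1 + I := mul_cauchyTransform τ h1 hz0
  have e2 := mul_integral_mul_inv_sub τ h1 h2 hz0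
  rw [← hI] at e2
  have b1 : ‖I‖ ≤ (∫ t, |t| ∂τ) / z.im := norm_integral_mul_inv_sub_ofReal_le h1 hz0
  have b2 := norm_integral_mul_inv_sub_ofReal_le h2 hz0
  have habs : ∫ t, |t ^ 2| ∂τ = s := by simp [hs]
  rw [habs] at b2
  have b3 : ‖G‖ ≤ z.im⁻¹ := norm_cauchyTransform_le τ hz0
  have b1' : ‖I‖ ≤ 1 / 200 := by
    refine b1.trans ?_
    rw [div_le_iff₀ hz0]; linarith
  have b2' : s / z.im ≤ 1 / 100 := by
    rw [div_le_iff₀ hz0]; linarith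
  have b3' : z.im⁻¹ ≤ 1 / 100 := by
    rw [inv_le_comm₀ hz0 (by norm_num)]; linarith
  have b4 : ‖z * I‖ ≤ (1 + s) / 2 + 1 / 100 := by
    rw [e2]
    refine (norm_add_le _ _).trans ?_
    rw [Complex.norm_real, Real.norm_eq_abs]
    linarith
  have b5 : ‖(z * G) * G‖ ≤ 1 / 2 := by
    rw [norm_mul, e1]
    have : ‖1 + I‖ ≤ 2 := by
      refine (norm_add_le _ _).trans ?_
      rw [norm_one]; linarith
    have := mul_le_mul this (b3.trans b3') (norm_nonneg _) (by norm_num)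
    linarith
  rw [← norm_mul]
  have e3 : ((z - G) ^ 2 - z ^ 2 + 2) * z = -2 * (z * I) + (z * G) * G := by
    linear_combination (-2 * z) * e1
  rw [e3]
  refine (norm_add_le _ _).trans ?_
  rw [norm_mul, norm_neg, Complex.norm_ofNat]
  linarith

/-- Telescoping comparison for the signed square root `r ↦ √r - √(-r)`. -/
lemma sub_le_signed_sqrt_sub_mul {a b A B : ℝ} (hab : b ≤ a) (hA : 0 ≤ A) (hB : 0 ≤ B)
    (haA : |a| ≤ A ^ 2) (hbB : |b| ≤ B ^ 2) :
    a - b ≤ ((√a - √(-a)) - (√b - √(-b))) * (A + B) := by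
  rcases le_total 0 a with ha | ha <;> rcases le_total 0 b with hb | hb
  · have h1 : √a ≤ A := Real.sqrt_le_iff.2 ⟨hA, (le_abs_self a).trans haA⟩
    have h2 : √b ≤ B := Real.sqrt_le_iff.2 ⟨hB, (le_abs_self b).trans hbB⟩
    rw [Real.sqrt_eq_zero'.2 (neg_nonpos.2 ha), Real.sqrt_eq_zero'.2 (neg_nonpos.2 hb)]
    have h3 : √b ≤ √a := Real.sqrt_le_sqrt hab
    nlinarith [Real.sq_sqrt ha, Real.sq_sqrt hb]
  · have h1 : √a ≤ A := Real.sqrt_le_iff.2 ⟨hA, (le_abs_self a).trans haA⟩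
    have h2 : √(-b) ≤ B := Real.sqrt_le_iff.2 ⟨hB, (neg_le_abs b).trans hbB⟩
    rw [Real.sqrt_eq_zero'.2 (neg_nonpos.2 ha), Real.sqrt_eq_zero'.2 hb]
    nlinarith [Real.sq_sqrt ha, Real.sq_sqrt (neg_nonneg.2 hb), Real.sqrt_nonneg a,
      Real.sqrt_nonneg (-b)]
  · have : a = 0 := by linarith
    have : b = 0 := by linarith
    subst a b
    simp
  · have h1 : √(-a) ≤ A := Real.sqrt_le_iff.2 ⟨hA, (neg_le_abs a).trans haA⟩
    have h2 : √(-b) ≤ B := Real.sqrt_le_iff.2 ⟨hB, (neg_le_abs b).trans hbB⟩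
    rw [Real.sqrt_eq_zero'.2 ha, Real.sqrt_eq_zero'.2 hb]
    have h3 : √(-a) ≤ √(-b) := Real.sqrt_le_sqrt (by linarith)
    nlinarith [Real.sq_sqrt (neg_nonneg.2 ha), Real.sq_sqrt (neg_nonneg.2 hb)]

lemma signed_sqrt_sub_le {a b : ℝ} (hab : b ≤ a) :
    (√a - √(-a)) - (√b - √(-b)) ≤ √(2 * (a - b)) := by
  apply Real.le_sqrt_of_sq_le
  rcases le_total 0 a with ha | ha <;> rcases le_total 0 b with hb | hb
  · rw [Real.sqrt_eq_zero'.2 (neg_nonpos.2 ha), Real.sqrt_eq_zero'.2 (neg_nonpos.2 hb)]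
    have h3 : √b ≤ √a := Real.sqrt_le_sqrt hab
    nlinarith [Real.sq_sqrt ha, Real.sq_sqrt hb, Real.sqrt_nonneg b]
  · rw [Real.sqrt_eq_zero'.2 (neg_nonpos.2 ha), Real.sqrt_eq_zero'.2 hb]
    nlinarith [Real.sq_sqrt ha, Real.sq_sqrt (neg_nonneg.2 hb), sq_nonneg (√a - √(-b))]
  · have : a = 0 := by linarith
    have : b = 0 := by linarith
    subst a b
    simp
  · rw [Real.sqrt_eq_zero'.2 ha, Real.sqrt_eq_zero'.2 hb]
    have h3 : √(-a) ≤ √(-b) := Real.sqrt_le_sqrt (by linarith)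
    nlinarith [Real.sq_sqrt (neg_nonneg.2 ha), Real.sq_sqrt (neg_nonneg.2 hb),
      Real.sqrt_nonneg (-a)]

/-- If the squares of a sequence nearly shift by `-2`, with an error controlled by the inverse
modulus, then the accumulated error over `n` steps is of order `√n`. -/
lemma norm_sq_sub_sq_add_le {w : ℕ → ℂ} {D : ℝ} (hD : 3 ≤ D)
    (him : ∀ k, 100 * D ≤ (w k).im)
    (hstep : ∀ k, ‖w (k + 1) ^ 2 - w k ^ 2 + 2‖ * ‖w k‖ ≤ D) (n : ℕ) :
    ‖w n ^ 2 - w 0 ^ 2 + 2 * n‖ ≤ 4 * D * √n := by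
  have hw : ∀ k, 100 * D ≤ ‖w k‖ := fun k =>
    (him k).trans ((le_abs_self _).trans (Complex.abs_im_le_norm _))
  set r : ℕ → ℝ := fun k => (w k ^ 2).re with hr
  set s : ℝ → ℝ := fun a => √a - √(-a) with hs
  have hsmall : ∀ k, ‖w (k + 1) ^ 2 - w k ^ 2 + 2‖ ≤ 1 / 100 := fun k => by
    have h1 := hstep k
    have h2 := mul_le_mul_of_nonneg_left (hw k) (norm_nonneg (w (k + 1) ^ 2 - w k ^ 2 + 2))
    nlinarith
  have hre : ∀ k, |r (k + 1) - r k + 2| ≤ 1 / 100 := fun k => by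
    have := (Complex.abs_re_le_norm _).trans (hsmall k)
    rwa [add_re, sub_re] at this
  have habs : ∀ k, |r k| ≤ ‖w k‖ ^ 2 := fun k => by
    rw [← norm_pow]; exact Complex.abs_re_le_norm _
  have hgrow : ∀ k, ‖w (k + 1)‖ ≤ 2 * ‖w k‖ := fun k => by
    have h1 : ‖w (k + 1) ^ 2‖ ≤ ‖w k ^ 2‖ + 3 := by
      have : w (k + 1) ^ 2 = w k ^ 2 + (w (k + 1) ^ 2 - w k ^ 2 + 2) + (-2) := by ring
      rw [this]
      refine (norm_add₃_le).trans ?_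
      have := hsmall k
      rw [norm_neg]
      norm_num at this ⊢
      linarith
    rw [norm_pow, norm_pow] at h1
    have := hw k
    refine le_of_sq_le_sq ?_ (by linarith)
    nlinarith
  have hone : ∀ k, ‖w (k + 1) ^ 2 - w k ^ 2 + 2‖ ≤ 1.6 * D * (s (r k) - s (r (k + 1))) := fun k => by
    have h1 := abs_le.1 (hre k)
    have h2 := sub_le_signed_sqrt_sub_mul (a := r k) (b := r (k + 1)) (by linarith)
      (norm_nonneg (w k)) (norm_nonneg (w (k + 1))) (habs k) (habs (k + 1))
    have hpos : 0 < ‖w k‖ := by linarith [hw k]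
    have h3 : 0 ≤ s (r k) - s (r (k + 1)) := by
      by_contra! hneg
      have : (s (r k) - s (r (k + 1))) * (‖w k‖ + ‖w (k + 1)‖) < 0 :=
        mul_neg_of_neg_of_pos hneg (by positivity)
      simp only [hs] at this
      linarith
    have h4 : 1.99 ≤ (s (r k) - s (r (k + 1))) * (3 * ‖w k‖) := by
      have := mul_le_mul_of_nonneg_left (a := s (r k) - s (r (k + 1)))
        (by linarith [hgrow k] : ‖w k‖ + ‖w (k + 1)‖ ≤ 3 * ‖w k‖) h3
      simp only [hs] at this ⊢
      linarith
    refine le_of_mul_le_mul_right ((hstep k).trans ?_) hpos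
    nlinarith
  have hsum : ∀ n : ℕ, ‖w n ^ 2 - w 0 ^ 2 + 2 * n‖ ≤ 1.6 * D * (s (r 0) - s (r n)) := fun n => by
    induction n with
    | zero => simp
    | succ k ih =>
      have : w (k + 1) ^ 2 - w 0 ^ 2 + 2 * ((k + 1 : ℕ) : ℂ) =
          (w k ^ 2 - w 0 ^ 2 + 2 * k) + (w (k + 1) ^ 2 - w k ^ 2 + 2) := by
        push_cast; ring
      rw [this]
      refine (norm_add_le _ _).trans ?_
      linarith [hone k]
  have hdrop : ∀ n : ℕ, r n ≤ r 0 ∧ r 0 - r n ≤ 2.01 * n := fun n => by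
    induction n with
    | zero => simp
    | succ k ih =>
      have h1 := abs_le.1 (hre k)
      push_cast
      constructor <;> linarith [ih.1, ih.2]
  refine (hsum n).trans ?_
  have h1 := signed_sqrt_sub_le (hdrop n).1
  have h2 : √(2 * (r 0 - r n)) ≤ 2.5 * √n := by
    refine Real.sqrt_le_iff.2 ⟨by positivity, ?_⟩
    rw [mul_pow, Real.sq_sqrt (Nat.cast_nonneg n)]
    have : (0 : ℝ) ≤ n := Nat.cast_nonneg n
    linarith [(hdrop n).2]
  have h3 : s (r 0) - s (r n) ≤ 2.5 * √n := h1.trans h2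
  nlinarith

open ProbabilityTheory in
lemma integral_cauchyPDFReal_eq_neg_im (τ : Measure ℝ) [IsFiniteMeasure τ] {y : NNReal}
    (hy : 0 < y) (u : ℝ) :
    ∫ t, cauchyPDFReal t y u ∂τ = -(cauchyTransform τ (u + y * I)).im / Real.pi := by
  have hz : 0 < ((u : ℂ) + y * I).im := by simpa using hy
  rw [im_cauchyTransform τ hz, integral_neg, neg_neg, ← integral_div]
  congr 1 with t
  simp only [cauchyPDFReal_def]
  simp
  ring

open ProbabilityTheory in
lemma ofReal_neg_im_cauchyTransform_div_pi (τ : Measure ℝ) [IsFiniteMeasure τ] {y : NNReal}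
    (hy : 0 < y) (u : ℝ) :
    ENNReal.ofReal (-(cauchyTransform τ (u + y * I)).im / Real.pi) =
      ∫⁻ t, cauchyPDF t y u ∂τ := by
  have hz : 0 < ((u : ℂ) + y * I).im := by simpa using hy
  rw [← integral_cauchyPDFReal_eq_neg_im τ hy, ofReal_integral_eq_lintegral_ofReal]
  · rfl
  · refine Integrable.of_bound (C := Real.pi⁻¹ * (y : ℝ) * ((y : ℝ) ^ 2)⁻¹) ?_
      (ae_of_all _ fun t => ?_)
    · simp only [cauchyPDFReal_def]
      exact Measurable.aestronglyMeasurable (by fun_prop)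
    · rw [Real.norm_of_nonneg (cauchyPDF_pos t hy.ne' u).le, cauchyPDFReal_def]
      have hy' : (0 : ℝ) < y := hy
      gcongr
      nlinarith [sq_nonneg (u - t)]
  · exact ae_of_all _ fun t => (cauchyPDF_pos t hy.ne' u).le

open ProbabilityTheory in
lemma measurable_cauchyPDF_uncurry (y : NNReal) :
    Measurable fun p : ℝ × ℝ => cauchyPDF p.1 y p.2 := by
  simp only [cauchyPDF, cauchyPDFReal_def]
  fun_prop

open ProbabilityTheory in
/-- Convolving with a Cauchy distribution turns the distribution function into the integral of the
imaginary part of the Cauchy transform. -/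
lemma lintegral_measure_Iic_sub_cauchyMeasure (τ : Measure ℝ) [IsFiniteMeasure τ] {y : NNReal}
    (hy : 0 < y) (x : ℝ) :
    ∫⁻ s, τ (Iic (x - s)) ∂(cauchyMeasure 0 y) =
      ∫⁻ u in Iic x, ENNReal.ofReal (-(cauchyTransform τ (u + y * I)).im / Real.pi) := by
  simp_rw [ofReal_neg_im_cauchyTransform_div_pi τ hy]
  have hset : MeasurableSet {p : ℝ × ℝ | p.1 + p.2 ≤ x} :=
    measurableSet_le (by fun_prop) (by fun_prop)
  have h1 : ∀ s, τ (Iic (x - s)) = ∫⁻ t, {p : ℝ × ℝ | p.1 + p.2 ≤ x}.indicator 1 (s, t) ∂τ := by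
    intro s
    rw [← lintegral_indicator_one measurableSet_Iic]
    congr 1 with t
    simp [Set.indicator_apply, le_sub_iff_add_le, add_comm]
  simp_rw [h1]
  have hm1 : AEMeasurable (Function.uncurry fun s t =>
      {p : ℝ × ℝ | p.1 + p.2 ≤ x}.indicator (1 : ℝ × ℝ → ENNReal) (s, t))
      ((cauchyMeasure 0 y).prod τ) := (measurable_one.indicator hset).aemeasurable
  have hm2 : AEMeasurable (Function.uncurry fun u t => cauchyPDF t y u)
      ((volume.restrict (Iic x)).prod τ) :=
    ((measurable_cauchyPDF_uncurry y).comp measurable_swap).aemeasurable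
  rw [lintegral_lintegral_swap hm1, lintegral_lintegral_swap hm2]
  · congr 1 with t
    rw [cauchyMeasure_of_scale_ne_zero 0 hy.ne', lintegral_withDensity_eq_lintegral_mul _
      (measurable_cauchyPDF 0 y), ← lintegral_indicator measurableSet_Iic,
      ← lintegral_sub_right_eq_self _ t]
    · congr 1 with u
      simp [Set.indicator_apply, cauchyPDF, cauchyPDFReal_def]
    · exact (measurable_one.indicator hset).comp (by fun_prop : Measurable fun s : ℝ => (s, t))

open ProbabilityTheory in
lemma integrable_neg_im_cauchyTransform (τ : Measure ℝ) [IsProbabilityMeasure τ] {y : NNReal}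
    (hy : 0 < y) :
    Integrable fun u : ℝ => -(cauchyTransform τ (u + y * I)).im / Real.pi := by
  have hnn : ∀ u : ℝ, 0 ≤ -(cauchyTransform τ (u + y * I)).im / Real.pi := fun u => by
    have := im_cauchyTransform_nonpos τ (z := (u : ℂ) + y * I) (by simpa using hy)
    exact div_nonneg (by linarith) Real.pi_pos.le
  have hm : Measurable fun u : ℝ => -(cauchyTransform τ (u + y * I)).im / Real.pi := by
    have : (fun u : ℝ => -(cauchyTransform τ (u + y * I)).im / Real.pi) =
        fun u => (∫⁻ t, cauchyPDF t y u ∂τ).toReal := by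
      ext u
      rw [← ofReal_neg_im_cauchyTransform_div_pi τ hy, ENNReal.toReal_ofReal (hnn u)]
    rw [this]
    exact (((measurable_cauchyPDF_uncurry y).comp measurable_swap).lintegral_prod_right').ennreal_toReal
  refine ⟨hm.aestronglyMeasurable, ?_⟩
  rw [hasFiniteIntegral_iff_ofReal (ae_of_all _ hnn)]
  simp_rw [ofReal_neg_im_cauchyTransform_div_pi τ hy]
  rw [lintegral_lintegral_swap]
  · simp [lintegral_cauchyPDF_eq_one _ hy.ne']
  · exact ((measurable_cauchyPDF_uncurry y).comp measurable_swap).aemeasurable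

lemma cdfOf_mono (τ : Measure ℝ) [IsFiniteMeasure τ] : Monotone (cdfOf τ) := fun _ _ h =>
  ENNReal.toReal_mono (measure_ne_top _ _) (measure_mono (Iic_subset_Iic.2 h))

lemma cdfOf_nonneg (τ : Measure ℝ) (x : ℝ) : 0 ≤ cdfOf τ x := ENNReal.toReal_nonneg

lemma cdfOf_le_one (τ : Measure ℝ) [IsProbabilityMeasure τ] (x : ℝ) : cdfOf τ x ≤ 1 :=
  measureReal_le_one

lemma integrable_cdfOf_sub (τ κ : Measure ℝ) [IsProbabilityMeasure τ] [IsFiniteMeasure κ] (x : ℝ) :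
    Integrable (fun s => cdfOf τ (x - s)) κ :=
  Integrable.of_bound ((cdfOf_mono τ).measurable.comp (by fun_prop)).aestronglyMeasurable 1
    (ae_of_all _ fun s => by
      rw [Real.norm_of_nonneg (cdfOf_nonneg _ _)]; exact cdfOf_le_one _ _)

open ProbabilityTheory in
lemma integral_cdfOf_sub_cauchyMeasure (τ : Measure ℝ) [IsProbabilityMeasure τ] {y : NNReal}
    (hy : 0 < y) (x : ℝ) :
    ∫ s, cdfOf τ (x - s) ∂(cauchyMeasure 0 y) =
      ∫ u in Iic x, -(cauchyTransform τ (u + y * I)).im / Real.pi := by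
  have hnn : ∀ u : ℝ, 0 ≤ -(cauchyTransform τ (u + y * I)).im / Real.pi := fun u => by
    have := im_cauchyTransform_nonpos τ (z := (u : ℂ) + y * I) (by simpa using hy)
    exact div_nonneg (by linarith) Real.pi_pos.le
  rw [integral_eq_lintegral_of_nonneg_ae (ae_of_all _ hnn)
      (integrable_neg_im_cauchyTransform τ hy).aestronglyMeasurable.restrict,
    ← lintegral_measure_Iic_sub_cauchyMeasure τ hy,
    integral_eq_lintegral_of_nonneg_ae (ae_of_all _ fun s => cdfOf_nonneg _ _)
      (integrable_cdfOf_sub τ _ x).aestronglyMeasurable]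
  congr 2 with s
  exact ENNReal.ofReal_toReal (measure_ne_top _ _)

open ProbabilityTheory in
lemma abs_integral_cdfOf_sub_cdfOf_le (μ γ : Measure ℝ) [IsProbabilityMeasure μ]
    [IsProbabilityMeasure γ] {y : NNReal} (hy : 0 < y) (x : ℝ) {g : ℝ → ℝ} (hg : Integrable g)
    (hle : ∀ u : ℝ, ‖cauchyTransform μ (u + y * I) - cauchyTransform γ (u + y * I)‖ ≤ g u) :
    |∫ s, (cdfOf μ (x - s) - cdfOf γ (x - s)) ∂(cauchyMeasure 0 y)| ≤ (∫ u, g u) / Real.pi := by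
  rw [integral_sub (integrable_cdfOf_sub μ _ x) (integrable_cdfOf_sub γ _ x),
    integral_cdfOf_sub_cauchyMeasure μ hy, integral_cdfOf_sub_cauchyMeasure γ hy,
    ← integral_sub (integrable_neg_im_cauchyTransform μ hy).integrableOn
      (integrable_neg_im_cauchyTransform γ hy).integrableOn, ← Real.norm_eq_abs, ← integral_div]
  have hg0 : ∀ u, 0 ≤ g u := fun u => (norm_nonneg _).trans (hle u)
  refine (norm_integral_le_of_norm_le (hg.div_const Real.pi).integrableOn
    (ae_of_all _ fun u => ?_)).trans (setIntegral_le_integral (hg.div_const _)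
      (ae_of_all _ fun u => div_nonneg (hg0 u) Real.pi_pos.le))
  rw [← sub_div, norm_div, Real.norm_of_nonneg Real.pi_pos.le]
  refine div_le_div_of_nonneg_right ?_ Real.pi_pos.le
  refine le_trans ?_ (hle u)
  have := Complex.abs_im_le_norm
    (cauchyTransform μ (u + y * I) - cauchyTransform γ (u + y * I))
  rw [sub_im, abs_sub_comm] at this
  rw [Real.norm_eq_abs]
  refine le_trans (le_of_eq ?_) this
  congr 1
  ring

open ProbabilityTheory in
lemma cauchyMeasure_real_Icc {y : NNReal} (hy : 0 < y) :
    (cauchyMeasure 0 y).real (Icc (-(√3 * y)) (√3 * y)) = 2 / 3 := by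
  have hy' : (0 : ℝ) < y := hy
  have hle : -(√3 * (y : ℝ)) ≤ √3 * y := by
    have : 0 ≤ √3 * (y : ℝ) := by positivity
    linarith
  rw [cauchyMeasure_of_scale_ne_zero 0 hy.ne', measureReal_def,
    withDensity_apply _ measurableSet_Icc]
  have h := ofReal_integral_eq_lintegral_ofReal (μ := volume.restrict (Icc (-(√3 * (y : ℝ))) (√3 * y)))
    (integrable_cauchyPDFReal 0 (γ := y)).integrableOn
    (ae_of_all _ fun t => (cauchyPDF_pos 0 hy.ne' t).le)
  have h' : ∫⁻ a in Icc (-(√3 * (y : ℝ))) (√3 * y), cauchyPDF 0 y a = _ := h.symm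
  rw [h', ENNReal.toReal_ofReal (integral_nonneg fun t => (cauchyPDF_pos 0 hy.ne' t).le),
    integral_Icc_eq_integral_Ioc, ← intervalIntegral.integral_of_le hle]
  simp only [cauchyPDFReal_def', sub_zero]
  rw [intervalIntegral.integral_const_mul,
    intervalIntegral.integral_comp_div (fun t : ℝ => (1 + t ^ 2)⁻¹) hy'.ne', neg_div,
    mul_div_cancel_right₀ _ hy'.ne', integral_inv_one_add_sq, Real.arctan_neg,
    Real.arctan_sqrt_three]
  simp only [smul_eq_mul]
  push_cast
  field_simp
  norm_num

open ProbabilityTheory in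
/-- One-sided desmoothing step. -/
lemma le_of_integral_sub_cauchyMeasure_le {f : ℝ → ℝ} (hf : Measurable f) {Δ L η : ℝ} (hL : 0 ≤ L)
    (hΔ : ∀ x, |f x| ≤ Δ) {y : NNReal} (hy : 0 < y) (x₀ : ℝ)
    (hinc : ∀ r, 0 ≤ r → f x₀ - L * √r ≤ f (x₀ + r))
    (hη : ∫ s, f (x₀ + √3 * y - s) ∂(cauchyMeasure 0 y) ≤ η) :
    f x₀ ≤ 3 / 2 * η + Δ / 2 + L * √(2 * (√3 * y)) := by
  set κ := cauchyMeasure 0 y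
  set a : ℝ := √3 * y with ha
  have hint : Integrable (fun s => f (x₀ + a - s)) κ :=
    Integrable.of_bound (hf.comp (by fun_prop)).aestronglyMeasurable Δ
      (ae_of_all _ fun s => by simpa using hΔ _)
  set A := Icc (-a) a
  have hA : MeasurableSet A := measurableSet_Icc
  have hPA : κ.real A = 2 / 3 := cauchyMeasure_real_Icc hy
  have hPAc : κ.real Aᶜ = 1 / 3 := by
    rw [measureReal_compl hA, hPA]; simp; norm_num
  rw [← integral_add_compl hA hint] at hη
  have h1 : 2 / 3 * (f x₀ - L * √(2 * a)) ≤ ∫ s in A, f (x₀ + a - s) ∂κ := by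
    have : ∫ _ in A, (f x₀ - L * √(2 * a)) ∂κ = 2 / 3 * (f x₀ - L * √(2 * a)) := by
      rw [setIntegral_const, hPA, smul_eq_mul]
    rw [← this]
    refine setIntegral_mono_on (integrable_const _) hint.integrableOn hA fun s hs => ?_
    have h2 := hinc (a - s) (by linarith [hs.2])
    have h3 : √(a - s) ≤ √(2 * a) := Real.sqrt_le_sqrt (by linarith [hs.1])
    rw [add_sub_assoc]
    linarith [mul_le_mul_of_nonneg_left h3 hL]
  have h2 : 1 / 3 * (-Δ) ≤ ∫ s in Aᶜ, f (x₀ + a - s) ∂κ := by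
    have : ∫ _ in Aᶜ, (-Δ) ∂κ = 1 / 3 * (-Δ) := by
      rw [setIntegral_const, hPAc, smul_eq_mul]
    rw [← this]
    exact integral_mono (integrable_const _) hint.integrableOn fun s => (abs_le.1 (hΔ _)).1
  linarith

open ProbabilityTheory in
lemma integral_comp_neg_cauchyMeasure {y : NNReal} (hy : 0 < y) (f : ℝ → ℝ) :
    ∫ s, f (-s) ∂(cauchyMeasure 0 y) = ∫ s, f s ∂(cauchyMeasure 0 y) := by
  have h : ∀ g : ℝ → ℝ, ∫ s, g s ∂(cauchyMeasure 0 y) = ∫ s, cauchyPDFReal 0 y s * g s := by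
    intro g
    rw [cauchyMeasure_of_scale_ne_zero 0 hy.ne',
      integral_withDensity_eq_integral_toReal_smul (measurable_cauchyPDF 0 y)
        (ae_of_all _ fun s => by simp [cauchyPDF])]
    congr 1 with s
    rw [cauchyPDF, ENNReal.toReal_ofReal (cauchyPDF_pos 0 hy.ne' s).le, smul_eq_mul]
  rw [h, h, ← integral_neg_eq_self (fun s => cauchyPDFReal 0 y s * f s)]
  congr 1 with s
  simp [cauchyPDFReal_def]

open ProbabilityTheory in
/-- A smoothing inequality: closeness of Cauchy transforms on a horizontal line gives closeness of
distribution functions when one of them is `1/2`-Hölder. -/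
theorem abs_cdfOf_sub_cdfOf_le (μ γ : Measure ℝ) [IsProbabilityMeasure μ]
    [IsProbabilityMeasure γ] {L : ℝ} (hL : 0 ≤ L)
    (hγ : ∀ x r, 0 ≤ r → cdfOf γ (x + r) ≤ cdfOf γ x + L * √r)
    {y : NNReal} (hy : 0 < y) {g : ℝ → ℝ} (hg : Integrable g)
    (hle : ∀ u : ℝ, ‖cauchyTransform μ (u + y * I) - cauchyTransform γ (u + y * I)‖ ≤ g u)
    (x : ℝ) :
    |cdfOf μ x - cdfOf γ x| ≤ 3 * ((∫ u, g u) / Real.pi) + 2 * (L * √(2 * (√3 * y))) := by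
  set η := (∫ u, g u) / Real.pi
  set f : ℝ → ℝ := fun x => cdfOf μ x - cdfOf γ x with hf
  have hfm : Measurable f := (cdfOf_mono μ).measurable.sub (cdfOf_mono γ).measurable
  have hη : ∀ x, |∫ s, f (x - s) ∂(cauchyMeasure 0 y)| ≤ η := fun x =>
    abs_integral_cdfOf_sub_cdfOf_le μ γ hy x hg hle
  have hbdd : BddAbove (range fun x => |f x|) := by
    refine ⟨1, ?_⟩
    rintro _ ⟨x, rfl⟩
    have := cdfOf_le_one μ x
    have := cdfOf_le_one γ x
    have := cdfOf_nonneg μ x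
    have := cdfOf_nonneg γ x
    exact abs_le.2 ⟨by simp only [hf]; linarith, by simp only [hf]; linarith⟩
  set Δ := ⨆ x, |f x|
  have hΔ : ∀ x, |f x| ≤ Δ := le_ciSup hbdd
  have hupper : ∀ x, f x ≤ 3 / 2 * η + Δ / 2 + L * √(2 * (√3 * y)) := fun x => by
    refine le_of_integral_sub_cauchyMeasure_le hfm hL hΔ hy x (fun r hr => ?_)
      ((le_abs_self _).trans (hη _))
    have h1 := cdfOf_mono μ (by linarith : x ≤ x + r)
    have h2 := hγ x r hr
    simp only [hf]
    linarith
  have hlower : ∀ x, -f x ≤ 3 / 2 * η + Δ / 2 + L * √(2 * (√3 * y)) := fun x => by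
    have h := le_of_integral_sub_cauchyMeasure_le (f := fun t => -f (-t)) (η := η)
      (hfm.comp measurable_neg).neg hL (fun t => by rw [abs_neg]; exact hΔ _) hy (-x)
      (fun r hr => ?_) ?_
    · simpa using h
    · have h1 := cdfOf_mono μ (by linarith : x - r ≤ x)
      have h2 := hγ (x - r) r hr
      simp only [hf, neg_neg, neg_add, ← sub_eq_add_neg] at *
      rw [sub_add_cancel] at h2
      linarith
    · rw [integral_neg, ← integral_comp_neg_cauchyMeasure hy]
      have h2 := (neg_le_abs _).trans (hη (x - √3 * y))
      refine le_trans (le_of_eq ?_) h2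
      congr 2 with s
      congr 1
      ring
  have hsup : Δ ≤ 3 / 2 * η + Δ / 2 + L * √(2 * (√3 * y)) :=
    ciSup_le fun x => abs_le.2 ⟨by linarith [hlower x], hupper x⟩
  linarith [hΔ x]

lemma image_sqrt_two_mul_cos_Ioo :
    (fun θ : ℝ => √2 * Real.cos θ) '' Ioo 0 Real.pi = {t | t ^ 2 < 2} := by
  have h2 : √2 ^ 2 = 2 := Real.sq_sqrt (by norm_num)
  have h0 : 0 < √2 := by positivity
  ext t
  simp only [mem_image, mem_ofPred_eq]
  constructor
  · rintro ⟨θ, hθ, rfl⟩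
    have := Real.sin_pos_of_mem_Ioo hθ
    nlinarith [Real.sin_sq_add_cos_sq θ]
  · intro ht
    have hlt : |t / √2| < 1 := by
      rw [abs_div, abs_of_pos h0, div_lt_one h0]
      exact abs_lt_of_sq_lt_sq (by rwa [h2]) h0.le
    rw [abs_lt] at hlt
    refine ⟨Real.arccos (t / √2), ⟨Real.arccos_pos.2 hlt.2, ?_⟩, ?_⟩
    · refine lt_of_le_of_ne (Real.arccos_le_pi _) fun h => ?_
      rw [Real.arccos_eq_pi] at h
      linarith
    · rw [Real.cos_arccos hlt.1.le hlt.2.le]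
      field_simp

/-- The arcsine distribution is the law of `√2 cos θ` for `θ` uniform in `(0, π)`. -/
lemma arcsine_eq_map :
    arcsine = (ENNReal.ofReal Real.pi⁻¹ • volume.restrict (Ioo 0 Real.pi)).map
      (fun θ => √2 * Real.cos θ) := by
  have h2 : √2 ^ 2 = 2 := Real.sq_sqrt (by norm_num)
  have hmeas : Measurable fun θ : ℝ => √2 * Real.cos θ := by fun_prop
  ext s hs
  rw [arcsine, withDensity_apply _ hs, Measure.map_apply hmeas hs, Measure.smul_apply, smul_eq_mul,
    ← lintegral_indicator_one (hmeas hs), ← lintegral_const_mul _ (measurable_one.indicator (hmeas hs)),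
    ← lintegral_indicator hs]
  have hsub : (s.indicator fun t : ℝ =>
      ENNReal.ofReal (if t ^ 2 < 2 then (Real.pi * √(2 - t ^ 2))⁻¹ else 0)) =
      ({t | t ^ 2 < 2} : Set ℝ).indicator (s.indicator fun t : ℝ =>
        ENNReal.ofReal (Real.pi * √(2 - t ^ 2))⁻¹) := by
    ext t
    by_cases hts : t ∈ s <;> by_cases ht : t ^ 2 < 2 <;> simp [hts, ht]
  rw [hsub, lintegral_indicator (measurableSet_lt (by fun_prop) (by fun_prop)),
    ← image_sqrt_two_mul_cos_Ioo,
    lintegral_image_eq_lintegral_abs_deriv_mul (f' := fun θ => √2 * -Real.sin θ) measurableSet_Ioo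
      (fun θ _ => ((Real.hasDerivAt_cos θ).const_mul _).hasDerivWithinAt)
      (fun a ha b hb h => Real.injOn_cos (Ioo_subset_Icc_self ha) (Ioo_subset_Icc_self hb)
        (mul_left_cancel₀ (by positivity) h))]
  refine setLIntegral_congr_fun measurableSet_Ioo fun θ hθ => ?_
  have hsin := Real.sin_pos_of_mem_Ioo hθ
  by_cases hθs : √2 * Real.cos θ ∈ s
  · have hθp : θ ∈ (fun θ : ℝ => √2 * Real.cos θ) ⁻¹' s := hθs
    rw [indicator_of_mem hθs, indicator_of_mem hθp, Pi.one_apply]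
    have : √(2 - (√2 * Real.cos θ) ^ 2) = √2 * Real.sin θ := by
      rw [Real.sqrt_eq_iff_mul_self_eq_of_pos (by positivity), mul_pow, h2]
      nlinarith [Real.sin_sq_add_cos_sq θ]
    rw [this, ← ENNReal.ofReal_mul (abs_nonneg _), mul_neg, abs_neg, abs_of_pos (by positivity)]
    rw [mul_one]
    field_simp
  · have hθp : θ ∉ (fun θ : ℝ => √2 * Real.cos θ) ⁻¹' s := hθs
    rw [indicator_of_notMem hθs, indicator_of_notMem hθp]
    simp

instance isProbabilityMeasure_arcsine : IsProbabilityMeasure arcsine where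
  measure_univ := by
    rw [arcsine_eq_map, Measure.map_apply (by fun_prop) MeasurableSet.univ]
    simp only [preimage_univ, Measure.smul_apply, Measure.restrict_apply_univ, Real.volume_Ioo,
      sub_zero, smul_eq_mul]
    rw [← ENNReal.ofReal_mul (inv_nonneg.2 Real.pi_pos.le), inv_mul_cancel₀ Real.pi_ne_zero,
      ENNReal.ofReal_one]

lemma cauchyTransform_arcsine (z : ℂ) :
    cauchyTransform arcsine z =
      (Real.pi : ℂ)⁻¹ * ∫ θ in (0 : ℝ)..Real.pi, (z - √2 * Real.cos θ)⁻¹ := by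
  rw [cauchyTransform, arcsine_eq_map, integral_map (by fun_prop)
    (measurable_inv_sub_ofReal z).aestronglyMeasurable, integral_smul_measure,
    ENNReal.toReal_ofReal (inv_nonneg.2 Real.pi_pos.le), intervalIntegral.integral_of_le
    Real.pi_pos.le, integral_Ioc_eq_integral_Ioo]
  simp

lemma integral_inv_sub_cos_two_pi {z : ℂ} (hz : 0 < z.im) :
    ∫ θ in (0 : ℝ)..2 * Real.pi, (z - √2 * Real.cos θ)⁻¹ =
      2 * ∫ θ in (0 : ℝ)..Real.pi, (z - √2 * Real.cos θ)⁻¹ := by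
  have hc : Continuous fun θ : ℝ => (z - √2 * Real.cos θ)⁻¹ := by
    refine Continuous.inv₀ (by fun_prop) fun θ => ?_
    have := sub_ofReal_ne_zero hz (√2 * Real.cos θ)
    push_cast at this ⊢
    exact this
  have h := intervalIntegral.integral_comp_sub_left (a := 0) (b := Real.pi)
    (fun θ : ℝ => (z - √2 * Real.cos θ)⁻¹) (2 * Real.pi)
  simp only [Real.cos_two_pi_sub, sub_zero] at h
  rw [show 2 * Real.pi - Real.pi = Real.pi by ring] at h
  rw [two_mul (∫ θ in (0 : ℝ)..Real.pi, (z - √2 * Real.cos θ)⁻¹)]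
  nth_rw 2 [h]
  rw [intervalIntegral.integral_add_adjacent_intervals (hc.intervalIntegrable _ _)
    (hc.intervalIntegrable _ _)]

/-- Joukowsky parametrization of the upper half-plane by the exterior of the unit disc. -/
lemma exists_joukowsky {z : ℂ} (hz : 0 < z.im) :
    ∃ u : ℂ, 1 < ‖u‖ ∧ √2 * z = u + u⁻¹ := by
  obtain ⟨s, hs⟩ := IsAlgClosed.exists_eq_mul_self ((√2 * z) ^ 2 - 4 : ℂ)
  set u := (√2 * z + s) / 2
  have hprod : u * (√2 * z - u) = 1 := by
    simp only [u]
    linear_combination (1 / 4) * hs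
  have hu0 : u ≠ 0 := fun h => by simp [h] at hprod
  have hinv : √2 * z - u = u⁻¹ := eq_inv_of_mul_eq_one_right hprod
  have hsum : √2 * z = u + u⁻¹ := by rw [← hinv]; ring
  have hne : ‖u‖ ≠ 1 := fun h => by
    have h1 := congrArg Complex.im hsum
    rw [Complex.inv_eq_conj h] at h1
    simp at h1
    exact hz.ne' h1
  rcases lt_or_gt_of_ne hne with h | h
  · refine ⟨u⁻¹, ?_, by rw [inv_inv, hsum]; ring⟩
    rw [norm_inv]
    exact (one_lt_inv₀ (norm_pos_iff.2 hu0)).2 h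
  · exact ⟨u, h, hsum⟩

lemma integral_inv_sub_cos {u z : ℂ} (hz : 0 < z.im) (hu : 1 < ‖u‖) (huz : √2 * z = u + u⁻¹) :
    ∫ θ in (0 : ℝ)..2 * Real.pi, (z - √2 * Real.cos θ)⁻¹ =
      2 * Real.pi * (√2 / (u - u⁻¹)) := by
  have hu0 : u ≠ 0 := fun h => by simp [h] at hu; linarith
  have hs2 : (√2 : ℂ) ^ 2 = 2 := by
    rw [← Complex.ofReal_pow, Real.sq_sqrt (by norm_num)]; simp
  have hmem : u⁻¹ ∈ Metric.ball (0 : ℂ) 1 := by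
    simpa using inv_lt_one_of_one_lt₀ hu
  have hne : ∀ w ∈ Metric.closedBall (0 : ℂ) 1, u - w ≠ 0 := fun w hw h => by
    rw [sub_eq_zero] at h
    rw [← h] at hw
    simp at hw
    linarith
  have hd : DifferentiableOn ℂ (fun w : ℂ => √2 / (u - w)) (Metric.closedBall 0 1) :=
    (differentiableOn_const _).div (by fun_prop) hne
  have h := hd.circleIntegral_sub_inv_smul hmem
  rw [circleIntegral] at h
  have hI : ∀ θ : ℝ, deriv (circleMap 0 1) θ • ((circleMap 0 1 θ - u⁻¹)⁻¹ •
      (√2 / (u - circleMap 0 1 θ))) = I * (z - √2 * Real.cos θ)⁻¹ := fun θ => by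
    have hw : ‖circleMap 0 1 θ‖ = 1 := by simp
    have hcos : (2 * Real.cos θ : ℂ) = circleMap 0 1 θ + (circleMap 0 1 θ)⁻¹ := by
      simp only [circleMap, ofReal_one, one_mul, zero_add, ofReal_cos, Complex.cos, neg_mul,
        Complex.exp_neg]
      ring
    set w := circleMap 0 1 θ
    have hw0 : w ≠ 0 := by rw [← norm_pos_iff, hw]; norm_num
    have h1 : u - w ≠ 0 := hne w (by simp [hw])
    have h2 : w - u⁻¹ ≠ 0 := fun h => by
      rw [sub_eq_zero] at h
      rw [h, norm_inv] at hw
      rw [inv_eq_one.1 hw] at hu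
      exact lt_irrefl _ hu
    have h3 : √2 * (z - √2 * Real.cos θ) = (u - w) * (w - u⁻¹) / w := by
      have : √2 * (z - √2 * Real.cos θ) = √2 * z - (√2 : ℂ) ^ 2 * Real.cos θ := by ring
      rw [this, huz, hs2, hcos]
      field_simp
      ring
    have h4 : z - √2 * Real.cos θ ≠ 0 := by
      have := sub_ofReal_ne_zero hz (√2 * Real.cos θ)
      push_cast at this ⊢
      exact this
    rw [deriv_circleMap, smul_eq_mul, smul_eq_mul]
    change w * I * _ = _
    rw [eq_mul_inv_iff_mul_eq₀ h4]
    rw [eq_div_iff hw0] at h3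
    have h5 : w * I * ((w - u⁻¹)⁻¹ * (√2 / (u - w))) * (z - √2 * Real.cos θ) =
        I * (√2 * (z - √2 * Real.cos θ) * w * ((u - w)⁻¹ * (w - u⁻¹)⁻¹)) := by
      rw [div_eq_mul_inv]; ring
    rw [h5, h3, mul_mul_mul_comm, mul_inv_cancel₀ h1, mul_inv_cancel₀ h2, one_mul, mul_one]
  simp_rw [hI] at h
  rw [intervalIntegral.integral_const_mul, smul_eq_mul] at h
  have := mul_left_cancel₀ Complex.I_ne_zero (h.trans (by ring : _ =
    I * (2 * Real.pi * (√2 / (u - u⁻¹)))))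
  exact this

/-- The Cauchy transform of the arcsine distribution is `1 / √(z² - 2)`. -/
theorem cauchyTransform_arcsine_sq_mul {z : ℂ} (hz : 0 < z.im) :
    cauchyTransform arcsine z ^ 2 * (z ^ 2 - 2) = 1 := by
  obtain ⟨u, hu, huz⟩ := exists_joukowsky hz
  have hs2 : (√2 : ℂ) ^ 2 = 2 := by
    rw [← Complex.ofReal_pow, Real.sq_sqrt (by norm_num)]; simp
  have hu0 : u ≠ 0 := fun h => by simp [h] at hu; linarith
  have hpi : (Real.pi : ℂ) ≠ 0 := Complex.ofReal_ne_zero.2 Real.pi_ne_zero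
  have h1 := (integral_inv_sub_cos_two_pi hz).symm.trans (integral_inv_sub_cos hz hu huz)
  have h2 : cauchyTransform arcsine z = √2 / (u - u⁻¹) := by
    rw [cauchyTransform_arcsine]
    rw [inv_mul_eq_iff_eq_mul₀ hpi]
    linear_combination h1 / 2
  have hne : u - u⁻¹ ≠ 0 := fun h => by
    rw [sub_eq_zero] at h
    have := congrArg norm h
    rw [norm_inv] at this
    have := inv_lt_one_of_one_lt₀ hu
    linarith
  have h3 : (u - u⁻¹) ^ 2 = 2 * (z ^ 2 - 2) := by
    have h4 : (√2 * z) ^ 2 = (u + u⁻¹) ^ 2 := by rw [huz]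
    rw [mul_pow, hs2] at h4
    linear_combination -h4 - 4 * (mul_inv_cancel₀ hu0)
  have h5 : z ^ 2 - 2 ≠ 0 := fun h => by
    rw [h, mul_zero] at h3
    exact hne (pow_eq_zero_iff (two_ne_zero) |>.1 h3)
  rw [h2, div_pow, h3, hs2]
  field_simp

lemma abs_sub_le_pi_mul_sqrt_cos_sub {θ φ : ℝ} (hθ : θ ∈ Icc 0 Real.pi) (hφ : φ ∈ Icc 0 Real.pi)
    {r : ℝ} (hr : |Real.cos θ - Real.cos φ| ≤ r) : |θ - φ| ≤ Real.pi * √r := by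
  wlog h : φ ≤ θ generalizing θ φ
  · rw [abs_sub_comm]
    exact this hφ hθ (by rwa [abs_sub_comm]) (le_of_not_ge h)
  have hpi := Real.pi_pos
  rw [abs_of_nonneg (sub_nonneg.2 h)]
  have h1 : Real.cos φ - Real.cos θ = 2 * Real.sin ((θ + φ) / 2) * Real.sin ((θ - φ) / 2) := by
    rw [Real.cos_sub_cos, ← neg_sub θ φ, neg_div, Real.sin_neg, add_comm]
    ring
  have h2 : (θ - φ) / Real.pi ≤ Real.sin ((θ - φ) / 2) := by
    have := Real.mul_le_sin (x := (θ - φ) / 2) (by linarith) (by linarith [hθ.2, hφ.1])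
    refine le_trans (le_of_eq ?_) this
    field_simp
  have h3 : Real.sin ((θ - φ) / 2) ≤ Real.sin ((θ + φ) / 2) := by
    rcases le_total ((θ + φ) / 2) (Real.pi / 2) with h | h
    · exact Real.sin_le_sin_of_le_of_le_pi_div_two (by linarith) h (by linarith [hφ.1])
    · rw [← Real.sin_pi_sub ((θ + φ) / 2)]
      exact Real.sin_le_sin_of_le_of_le_pi_div_two (by linarith) (by linarith)
        (by linarith [hθ.2])
  have h0 : 0 ≤ (θ - φ) / Real.pi := div_nonneg (by linarith) hpi.le
  have h4 : ((θ - φ) / Real.pi) ^ 2 ≤ r := by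
    have := (neg_le_abs _).trans hr
    nlinarith
  have := Real.le_sqrt_of_sq_le h4
  rwa [div_le_iff₀ hpi, mul_comm] at this

lemma cdfOf_arcsine_add_le (x r : ℝ) (hr : 0 ≤ r) :
    cdfOf arcsine (x + r) ≤ cdfOf arcsine x + 1 * √r := by
  have hpi := Real.pi_pos
  have hunion : Iic (x + r) = Iic x ∪ Ioc x (x + r) := (Iic_union_Ioc_eq_Iic (by linarith)).symm
  have h1 : cdfOf arcsine (x + r) ≤ cdfOf arcsine x + arcsine.real (Ioc x (x + r)) := by
    simp only [cdfOf]
    rw [hunion]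
    exact measureReal_union_le _ _
  refine h1.trans (add_le_add_right ?_ _)
  rw [one_mul, measureReal_def]
  refine ENNReal.toReal_le_of_le_ofReal (Real.sqrt_nonneg _) ?_
  rw [arcsine_eq_map, Measure.map_apply (by fun_prop) measurableSet_Ioc, Measure.smul_apply,
    Measure.restrict_apply' measurableSet_Ioo, smul_eq_mul]
  set S := (fun θ => √2 * Real.cos θ) ⁻¹' Ioc x (x + r) ∩ Ioo 0 Real.pi
  have hdiam : Metric.ediam S ≤ ENNReal.ofReal (Real.pi * √r) := by
    refine Metric.ediam_le fun θ hθ φ hφ => ?_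
    rw [edist_dist, Real.dist_eq]
    refine ENNReal.ofReal_le_ofReal (abs_sub_le_pi_mul_sqrt_cos_sub
      (Ioo_subset_Icc_self hθ.2) (Ioo_subset_Icc_self hφ.2) ?_)
    have h2 : 1 ≤ √2 := Real.one_le_sqrt.2 (by norm_num)
    have h3 : |√2 * Real.cos θ - √2 * Real.cos φ| ≤ r :=
      abs_le.2 ⟨by linarith [hθ.1.1, hφ.1.2], by linarith [hθ.1.2, hφ.1.1]⟩
    rw [← mul_sub, abs_mul, abs_of_pos (by linarith)] at h3
    nlinarith [abs_nonneg (Real.cos θ - Real.cos φ)]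
  calc ENNReal.ofReal Real.pi⁻¹ * volume S
      ≤ ENNReal.ofReal Real.pi⁻¹ * ENNReal.ofReal (Real.pi * √r) := by
        gcongr
        exact (Real.volume_le_diam S).trans hdiam
    _ = ENNReal.ofReal √r := by
        rw [← ENNReal.ofReal_mul (inv_nonneg.2 hpi.le), inv_mul_cancel_left₀ hpi.ne']

/-- Stability of the inverse square root in the upper half-plane at the radicand `z ^ 2 - 2`. -/
lemma norm_inv_sub_inv_le {z S F δ : ℂ} (hz : 0 < z.im) (hS : 0 < S.im) (hF : z.im ≤ F.im)
    (hS2 : S ^ 2 = z ^ 2 - 2) (hF2 : F ^ 2 = S ^ 2 + δ) (hδ : ‖δ‖ ≤ z.im / 25)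
    (hSy : z.im ≤ ‖S‖ ^ 2) : ‖F⁻¹ - S⁻¹‖ ≤ 2 * ‖δ‖ / ‖S‖ ^ 3 := by
  have hF0 : 0 < F.im := hz.trans_le hF
  have hSpos : 0 < ‖S‖ := hS.trans_le ((le_abs_self _).trans (Complex.abs_im_le_norm _))
  have hFpos : 0 < ‖F‖ := hF0.trans_le ((le_abs_self _).trans (Complex.abs_im_le_norm _))
  have hprod : ‖F - S‖ * ‖F + S‖ = ‖δ‖ := by
    rw [← norm_mul]; congr 1; linear_combination hF2
  have hsum : ‖S‖ ≤ ‖F + S‖ := by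
    have hSre := congrArg Complex.re hS2
    have hSim := congrArg Complex.im hS2
    have hFim := congrArg Complex.im hF2
    rw [hS2] at hFim
    simp only [pow_two, mul_re, mul_im, sub_re, sub_im, add_im, re_ofNat, im_ofNat] at hSre hSim hFim
    rcases lt_or_ge |z.re| (1 / 2) with hx | hx
    · have hx2 : z.re * z.re < 1 / 4 := by
        have := abs_lt.1 hx; nlinarith
      have hS1 : 1 ≤ ‖S‖ := by
        have h1 : 1 ≤ ‖S‖ ^ 2 := by
          rw [← norm_pow]
          refine le_trans ?_ ((neg_le_abs _).trans (Complex.abs_re_le_norm _))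
          simp only [pow_two, mul_re]
          nlinarith
        nlinarith
      have h2 : z.im ≤ ‖F + S‖ := by
        refine le_trans ?_ ((le_abs_self _).trans (Complex.abs_im_le_norm _))
        rw [add_im]; linarith
      have h3 : ‖F - S‖ ≤ 1 / 25 := by
        have := mul_le_mul_of_nonneg_left h2 (norm_nonneg (F - S))
        rw [hprod] at this
        refine le_of_mul_le_mul_right (this.trans ?_) hz
        linarith
      have h4 : ‖S + S‖ ≤ ‖F + S‖ + ‖F - S‖ := by
        have : S + S = (F + S) - (F - S) := by ring
        rw [this]; exact norm_sub_le _ _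
      rw [← two_mul, norm_mul, Complex.norm_ofNat] at h4
      linarith
    · have hδim := (abs_le.1 ((Complex.abs_im_le_norm δ).trans hδ))
      have hsign : 0 ≤ F.re * S.re := by
        rcases le_abs'.1 hx with hx | hx
        · have hS' : S.re ≤ 0 := by nlinarith
          have hF' : F.re ≤ 0 := by nlinarith
          exact mul_nonneg_of_nonpos_of_nonpos hF' hS'
        · have hS' : 0 ≤ S.re := by nlinarith
          have hF' : 0 ≤ F.re := by nlinarith
          exact mul_nonneg hF' hS'
      refine le_of_sq_le_sq ?_ (norm_nonneg _)
      rw [Complex.sq_norm, Complex.sq_norm, Complex.normSq_apply, Complex.normSq_apply, add_re,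
        add_im]
      nlinarith [mul_self_nonneg F.re]
  have hdiff : ‖F - S‖ * ‖S‖ ≤ ‖δ‖ := by
    rw [← hprod]; exact mul_le_mul_of_nonneg_left hsum (norm_nonneg _)
  have hFS : ‖S‖ ≤ 2 * ‖F‖ := by
    have h1 : ‖S ^ 2‖ ≤ ‖F ^ 2‖ + ‖δ‖ := by
      have : S ^ 2 = F ^ 2 - δ := by rw [hF2]; ring
      rw [this]; exact norm_sub_le _ _
    rw [norm_pow, norm_pow] at h1
    refine le_of_sq_le_sq ?_ (by positivity)
    nlinarith [sq_nonneg ‖F‖]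
  have hF00 : F ≠ 0 := norm_pos_iff.1 hFpos
  have hS00 : S ≠ 0 := norm_pos_iff.1 hSpos
  rw [inv_sub_inv hF00 hS00, norm_div, norm_mul, norm_sub_rev, div_le_div_iff₀ (by positivity)
    (by positivity)]
  calc ‖F - S‖ * ‖S‖ ^ 3 = (‖F - S‖ * ‖S‖) * (‖S‖ * ‖S‖) := by ring
    _ ≤ ‖δ‖ * ((2 * ‖F‖) * ‖S‖) := by gcongr
    _ = _ := by ring

lemma le_norm_sq_sub_two {z S : ℂ} (hS2 : S ^ 2 = z ^ 2 - 2) :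
    min (max z.im |z.re - √2|) (max z.im |z.re + √2|) ≤ ‖S‖ ^ 2 := by
  have hs2 : (√2 : ℂ) ^ 2 = 2 := by
    rw [← Complex.ofReal_pow, Real.sq_sqrt (by norm_num)]; simp
  have hfac : ‖S‖ ^ 2 = ‖z - √2‖ * ‖z + √2‖ := by
    rw [← norm_pow, ← norm_mul, hS2]; congr 1; linear_combination hs2
  have h1 : max z.im |z.re - √2| ≤ ‖z - √2‖ :=
    max_le ((le_abs_self _).trans (by simpa using Complex.abs_im_le_norm (z - √2)))
      (by simpa using Complex.abs_re_le_norm (z - √2))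
  have h2 : max z.im |z.re + √2| ≤ ‖z + √2‖ :=
    max_le ((le_abs_self _).trans (by simpa using Complex.abs_im_le_norm (z + √2)))
      (by simpa using Complex.abs_re_le_norm (z + √2))
  have h3 : 2 ≤ ‖z - √2‖ + ‖z + √2‖ := by
    have h4 : ‖(2 * √2 : ℂ)‖ ≤ ‖z + √2‖ + ‖z - √2‖ := by
      have : (2 * √2 : ℂ) = (z + √2) - (z - √2) := by ring
      rw [this]; exact norm_sub_le _ _
    have h5 : 1 ≤ √2 := Real.one_le_sqrt.2 (by norm_num)
    rw [norm_mul, Complex.norm_ofNat, Complex.norm_real, Real.norm_of_nonneg (by linarith)] at h4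
    linarith
  rw [hfac]
  rcases le_total 1 ‖z + √2‖ with h | h
  · refine (min_le_left _ _).trans (h1.trans ?_)
    nlinarith [norm_nonneg (z - √2)]
  · refine (min_le_right _ _).trans (h2.trans ?_)
    nlinarith [norm_nonneg (z + √2)]

lemma inv_pow_three_le_of_min_le {a b s : ℝ} (ha : 0 < a) (hb : 0 < b) (hs : 0 ≤ s)
    (h : min a b ≤ s ^ 2) :
    1 / s ^ 3 ≤ a ^ (-(3 : ℝ) / 2) + b ^ (-(3 : ℝ) / 2) := by
  have key : ∀ c : ℝ, 0 < c → c ≤ s ^ 2 → 1 / s ^ 3 ≤ c ^ (-(3 : ℝ) / 2) := fun c hc hcs => by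
    have h1 := Real.rpow_le_rpow_of_nonpos hc hcs (by norm_num : -(3 : ℝ) / 2 ≤ 0)
    refine le_trans (le_of_eq ?_) h1
    rw [← Real.rpow_natCast s 2, ← Real.rpow_mul hs, one_div, ← Real.rpow_natCast s 3,
      ← Real.rpow_neg hs]
    norm_num
  rcases min_le_iff.1 h with h | h
  · linarith [key a ha h, Real.rpow_nonneg hb.le (-(3 : ℝ) / 2)]
  · linarith [key b hb h, Real.rpow_nonneg ha.le (-(3 : ℝ) / 2)]

lemma integrableOn_Ioi_max_rpow {y : ℝ} (hy : 0 < y) :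
    IntegrableOn (fun t => max y t ^ (-(3 : ℝ) / 2)) (Ioi 0) := by
  rw [← Ioc_union_Ioi_eq_Ioi hy.le]
  refine IntegrableOn.union ?_ ?_
  · refine (integrableOn_const (C := y ^ (-(3 : ℝ) / 2)) (by simp)).congr_fun (fun t ht => ?_)
      measurableSet_Ioc
    simp only [max_eq_left ht.2]
  · refine (integrableOn_Ioi_rpow_of_lt (by norm_num : -(3 : ℝ) / 2 < -1) hy).congr_fun
      (fun t ht => ?_) measurableSet_Ioi
    simp only [max_eq_right (mem_Ioi.1 ht).le]

lemma integral_max_abs_rpow {y : ℝ} (hy : 0 < y) :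
    ∫ t, max y |t| ^ (-(3 : ℝ) / 2) = 6 / √y := by
  rw [integral_comp_abs (f := fun t => max y t ^ (-(3 : ℝ) / 2)), ← Ioc_union_Ioi_eq_Ioi hy.le,
    setIntegral_union (Ioc_disjoint_Ioi le_rfl) measurableSet_Ioi
      ((integrableOn_Ioi_max_rpow hy).mono_set Ioc_subset_Ioi_self)
      ((integrableOn_Ioi_max_rpow hy).mono_set (Ioi_subset_Ioi hy.le)),
    setIntegral_congr_fun (g := fun _ => y ^ (-(3 : ℝ) / 2)) measurableSet_Ioc
      (fun t ht => by simp only [max_eq_left ht.2]),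
    setIntegral_congr_fun (g := fun t => t ^ (-(3 : ℝ) / 2)) measurableSet_Ioi
      (fun t ht => by simp only [max_eq_right (mem_Ioi.1 ht).le]),
    integral_Ioi_rpow_of_lt (by norm_num) hy, setIntegral_const]
  have h1 : y * y ^ (-(3 : ℝ) / 2) = (√y)⁻¹ := by
    rw [Real.sqrt_eq_rpow, ← Real.rpow_neg hy.le, ← Real.rpow_one_add' hy.le (by norm_num)]
    norm_num
  have h2 : y ^ (-(3 : ℝ) / 2 + 1) = (√y)⁻¹ := by
    rw [← h1, Real.rpow_add_one hy.ne', mul_comm]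
  rw [h2, smul_eq_mul, Real.volume_real_Ioc_of_le hy.le, sub_zero, h1]
  ring

lemma integrable_max_abs_rpow {y : ℝ} (hy : 0 < y) :
    Integrable (fun t => max y |t| ^ (-(3 : ℝ) / 2)) := by
  refine Integrable.of_integral_ne_zero ?_
  rw [integral_max_abs_rpow hy]
  positivity

/-- Quantitative convergence towards the arcsine distribution, in terms of the scale `ε`. -/
theorem abs_cdfOf_sub_cdfOf_arcsine_le (μ : Measure ℝ) [IsProbabilityMeasure μ] {ε : ℝ}
    (hε : 0 < ε)
    (hμ : ∀ z : ℂ, z.im = 100 * ε → ∃ W : ℂ, z.im ≤ W.im ∧ cauchyTransform μ z = W⁻¹ ∧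
      ‖W ^ 2 - (z ^ 2 - 2)‖ ≤ 4 * ε) (x : ℝ) :
    |cdfOf μ x - cdfOf arcsine x| ≤ 200 * √ε := by
  set y : NNReal := ⟨100 * ε, by positivity⟩
  have hyε : (y : ℝ) = 100 * ε := rfl
  have hy : 0 < y := by rw [← NNReal.coe_pos, hyε]; positivity
  have hy' : (0 : ℝ) < y := hy
  set h : ℝ → ℝ := fun t => max (y : ℝ) |t| ^ (-(3 : ℝ) / 2) with hh
  have hhi : Integrable h := integrable_max_abs_rpow hy'
  have hhv : ∫ t, h t = 6 / √y := integral_max_abs_rpow hy'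
  set g : ℝ → ℝ := fun u => 8 * ε * (h (u - √2) + h (u + √2)) with hg
  have hgi : Integrable g := ((hhi.comp_sub_right √2).add (hhi.comp_add_right √2)).const_mul _
  have hgv : ∫ u, g u = 96 * ε / √y := by
    rw [hg, integral_const_mul, integral_add (hhi.comp_sub_right √2) (hhi.comp_add_right √2),
      integral_sub_right_eq_self h, integral_add_right_eq_self h, hhv]
    ring
  have hle : ∀ u : ℝ,
      ‖cauchyTransform μ (u + y * I) - cauchyTransform arcsine (u + y * I)‖ ≤ g u := by
    intro u
    set z : ℂ := u + y * I with hzdef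
    have hzim : z.im = y := by simp [hzdef]
    have hzre : z.re = u := by simp [hzdef]
    have hz : 0 < z.im := by rw [hzim]; exact hy'
    obtain ⟨W, hWim, hWG, hW2⟩ := hμ z (by rw [hzim, hyε])
    have hG2 := cauchyTransform_arcsine_sq_mul hz
    set G := cauchyTransform arcsine z with hG
    have hG0 : G ≠ 0 := fun h0 => by simp [h0] at hG2
    have hS2 : (G⁻¹) ^ 2 = z ^ 2 - 2 := by
      rw [inv_pow]
      exact inv_eq_of_mul_eq_one_right hG2
    have hGim : G.im ≤ 0 := im_cauchyTransform_nonpos arcsine hz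
    have hmin := le_norm_sq_sub_two hS2
    have hSy : z.im ≤ ‖G⁻¹‖ ^ 2 := le_trans (le_min (le_max_left _ _) (le_max_left _ _)) hmin
    have hSim : 0 < (G⁻¹).im := by
      rw [Complex.inv_im]
      refine div_pos (neg_pos.2 (lt_of_le_of_ne hGim fun h0 => ?_)) (Complex.normSq_pos.2 hG0)
      have h1 := congrArg Complex.im hS2
      have h2 := congrArg Complex.re hS2
      simp only [pow_two, mul_re, mul_im, sub_re, sub_im, re_ofNat, im_ofNat] at h1 h2
      have h3 : (G⁻¹).im = 0 := by rw [Complex.inv_im, h0]; simp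
      rw [h3] at h1 h2
      have h4 : z.re = 0 := by
        have : z.re * z.im = 0 := by linarith
        exact (mul_eq_zero.1 this).resolve_right hz.ne'
      rw [h4] at h2
      nlinarith [mul_self_nonneg (G⁻¹).re]
    have hδ : ‖W ^ 2 - (z ^ 2 - 2)‖ ≤ z.im / 25 := by rw [hzim, hyε]; linarith
    have key := norm_inv_sub_inv_le (δ := W ^ 2 - (z ^ 2 - 2)) hz hSim hWim hS2
      (by rw [hS2]; ring) hδ hSy
    rw [inv_inv, ← hWG] at key
    rw [hzim, hzre] at hmin
    have h3 := inv_pow_three_le_of_min_le (lt_max_of_lt_left hy') (lt_max_of_lt_left hy')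
      (norm_nonneg _) hmin
    calc _ ≤ _ := key
      _ = 2 * ‖W ^ 2 - (z ^ 2 - 2)‖ * (1 / ‖G⁻¹‖ ^ 3) := by ring
      _ ≤ 2 * (4 * ε) * (h (u - √2) + h (u + √2)) := by gcongr
      _ = g u := by simp only [hg]; ring
  have main := abs_cdfOf_sub_cdfOf_le μ arcsine zero_le_one cdfOf_arcsine_add_le hy hgi hle x
  have hsε : 0 < √ε := Real.sqrt_pos.2 hε
  have hsy : √(y : ℝ) = 10 * √ε := by
    rw [hyε, Real.sqrt_mul (by norm_num), show (100 : ℝ) = 10 ^ 2 by norm_num,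
      Real.sqrt_sq (by norm_num)]
  have e1 : (∫ u, g u) / Real.pi ≤ 9.6 * √ε := by
    have : (∫ u, g u) = 9.6 * √ε := by
      rw [hgv, hsy, div_eq_iff (by positivity)]
      nlinarith [Real.sq_sqrt hε.le]
    rw [this]
    exact div_le_self (by positivity) (by linarith [Real.pi_gt_three])
  have e2 : √(2 * (√3 * y)) ≤ 20 * √ε := by
    refine Real.sqrt_le_iff.2 ⟨by positivity, ?_⟩
    have h3 : √3 ≤ 2 := Real.sqrt_le_iff.2 (by norm_num)
    rw [mul_pow, Real.sq_sqrt hε.le, hyε]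
    nlinarith
  linarith

/-- Berry–Esseen type estimate for the monotone CLT, rate `n^{-1/4}`
under a finite first absolute moment of the Nevanlinna measure `ρ` of `F_ν`. -/
theorem berry_esseen_monotone_clt_rate_quarter
    (ν : Measure ℝ) [IsFiniteMeasure ν] (hν1 : ν Set.univ = 1)
    (hint1 : Integrable (fun t => t) ν) (hint2 : Integrable (fun t => t ^ 2) ν)
    (hintabs : Integrable (fun t => |t|) ν)
    (m m2 : ℝ) (hm : m = ∫ t, t ∂ν) (hm2 : m2 = ∫ t, t ^ 2 ∂ν)
    (hcpos : 0 < ∫ t, |t| ∂ν)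
    (ρ : Measure ℝ) [IsFiniteMeasure ρ]
    (hρint : Integrable (fun t => |t|) ρ)
    (d : ℝ) (hd : d = ∫ t, |t| ∂ρ)
    (hNevanlinna : ∀ z : ℂ, 0 < z.im →
      (∫ t, (z - (t : ℂ))⁻¹ ∂ν) * (z - (m : ℂ) - ∫ s, (z - (s : ℂ))⁻¹ ∂ρ) = 1)
    (F : ℂ → ℂ) (hF : ∀ z : ℂ, F z = z + ∫ t, ((t : ℂ) - z)⁻¹ ∂ν)
    (μ : ℕ → Measure ℝ) (hprob : ∀ n, IsProbabilityMeasure (μ n))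
    (hcauchy : ∀ n : ℕ, 1 ≤ n → ∀ z : ℂ, 0 < z.im →
      ∫ t, (z - (t : ℂ))⁻¹ ∂(μ n)
        = (Real.sqrt n : ℂ) / F^[n] ((Real.sqrt n : ℂ) * z))
    (n : ℕ)
    (hn : max (max (4 * m ^ 2) (4 * m2 ^ 2))
        (12288 * (d + 3 * (1 + m2) ^ 2) ^ 2) < (n : ℝ)) :
    ∀ x : ℝ, |cdfOf (μ n) x - cdfOf arcsine x| ≤
      200 * Real.sqrt (d + 3 * (1 + m2) ^ 2) * (n : ℝ) ^ (-(1 : ℝ) / 4) := by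
  intro x
  have : IsProbabilityMeasure ν := ⟨hν1⟩
  have hm2' : 0 ≤ m2 := hm2 ▸ integral_nonneg fun t => sq_nonneg t
  have hd' : 0 ≤ d := hd ▸ integral_nonneg fun t => abs_nonneg t
  set D := d + 3 * (1 + m2) ^ 2 with hD
  have hD2 : 3 * (1 + m2) ≤ D := by nlinarith
  have hD3 : 3 ≤ D := by linarith
  have hn0 : (0 : ℝ) < n := lt_of_le_of_lt (le_max_of_le_right (by positivity)) hn
  have hn1 : 1 ≤ n := Nat.one_le_iff_ne_zero.2 (Nat.cast_pos.1 hn0).ne'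
  have hsn : 0 < √(n : ℝ) := Real.sqrt_pos.2 hn0
  have hsn2 : (√(n : ℝ) : ℂ) ^ 2 = n := by
    rw [← Complex.ofReal_pow, Real.sq_sqrt hn0.le, Complex.ofReal_natCast]
  have hFG : ∀ w, F w = w - cauchyTransform ν w := fun w => by
    rw [hF, cauchyTransform, sub_eq_add_neg, ← integral_neg]
    simp only [← inv_neg, neg_sub]
  have := hprob n
  have hmain := abs_cdfOf_sub_cdfOf_arcsine_le (μ n) (ε := D / √n) (by positivity)
    (fun z hz => ?_) x
  · refine hmain.trans_eq ?_
    rw [Real.sqrt_div' _ (Real.sqrt_nonneg _), mul_assoc, Real.sqrt_eq_rpow (n : ℝ),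
      Real.sqrt_eq_rpow ((n : ℝ) ^ (1 / 2 : ℝ)), ← Real.rpow_mul hn0.le, div_eq_mul_inv,
      ← Real.rpow_neg hn0.le]
    norm_num
  · set w : ℕ → ℂ := fun k => F^[k] (√n * z) with hw
    have hsucc : ∀ k, w (k + 1) = w k - cauchyTransform ν (w k) := fun k => by
      simp only [hw, Function.iterate_succ_apply', hFG]
    have hw0 : (w 0).im = 100 * D := by
      simp only [hw, Function.iterate_zero, id, im_ofReal_mul, hz]
      field_simp
    have hmono : ∀ k, (w 0).im ≤ (w k).im := fun k => by
      induction k with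
      | zero => exact le_rfl
      | succ k ih =>
        have := im_cauchyTransform_nonpos ν (z := w k) (by linarith)
        rw [hsucc, sub_im]
        linarith
    have him : ∀ k, 100 * D ≤ (w k).im := fun k => hw0 ▸ hmono k
    have hstep : ∀ k, ‖w (k + 1) ^ 2 - w k ^ 2 + 2‖ * ‖w k‖ ≤ D := fun k => by
      rw [hsucc]
      refine (norm_sq_sub_cauchyTransform_le ν hint1 hint2 ?_).trans ?_
      · rw [← hm2]; linarith [him k]
      · rw [← hm2]; linarith
    have hbound := norm_sq_sub_sq_add_le hD3 him hstep n
    refine ⟨w n / √n, ?_, ?_, ?_⟩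
    · rw [div_ofReal_im, le_div_iff₀ hsn]
      refine le_trans (le_of_eq ?_) (hmono n)
      simp only [hw, Function.iterate_zero, id, im_ofReal_mul]
      exact mul_comm _ _
    · rw [inv_div, cauchyTransform, hcauchy n hn1 z (by rw [hz]; positivity)]
    · have : (w n / √n) ^ 2 - (z ^ 2 - 2) = (w n ^ 2 - w 0 ^ 2 + 2 * n) / n := by
        have hnC : (n : ℂ) ≠ 0 := by exact_mod_cast hn0.ne'
        simp only [hw, Function.iterate_zero, id, div_pow, mul_pow, hsn2]
        field_simp
        ring
      rw [this, norm_div, Complex.norm_natCast, div_le_iff₀ hn0]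
      refine hbound.trans_eq ?_
      have : (n : ℝ) = √n * √n := (Real.mul_self_sqrt hn0.le).symm
      rw [mul_assoc, mul_assoc, mul_left_cancel_iff_of_pos four_pos]
      nth_rw 3 [this]
      field_simp
end
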